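/- Let $d\ge 3$, let $T$ be the $d$-regular tree with base vertex $O$, orient every edge away from $O$ (an edge $e$ with origin $oe$ and terminus $te$ is positively oriented if $d(O,te)>d(O,oe)$), and fix a legal coloring of the directed edges by $\{0,\dots,d-1\}$ (bijective on the star of every vertex) giving color $0$ to all edges that are not positively oriented. Let $A=\mathrm{Aut}(T)$ with the topology of pointwise convergence, and let $\mu$ be its Haar measure, normalized so that vertex stabilizers have measure $1$. For an edge $f$ put $\mathrm{Shadow}[f]=\{v : tf\in[of,v]\}$; for positively oriented $f$ this is a $(d-1)$-ary tree rooted at $tf$, and $\mathrm{Aut}(\mathrm{Shadow}[f])$ is the compact group of its root-preserving automorphisms. Let $\Gamma\le A$ be a countable subgroup acting almost freely (every nontrivial element fixes only finitely many vertices). Let $w=w_0\cdots w_n\in\Gamma*\langle t\rangle$ be a nontrivial cyclically reduced word in canonical form: each $w_i$ is $t$, $t^{-1}$ or a nontrivial element of $\Gamma$, and no two consecutive letters (nor, if $n\geq 1$, the last and the first letter) are both in $\Gamma$ or of the form $t,t^{-1}$ or $t^{-1},t$. For $a\in A$ let $w_i(a)$ and $w(a)$ be obtained by substituting $a$ for $t$,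 where the letters of $w$ act successively, $w_0$ first. The trace under $w(a)$ of an edge or vertex $x$ is the sequence $x_0=x$, $x_{i+1}=$ the image of $x_i$ under $w_i(a)$, $0\le i\le n$. Let $e$ be a positively oriented edge and let $\mathcal T=(e_0,\dots,e_{n+1})$ be a fixed sequence of positively oriented edges with $e_0=e_{n+1}=e$ and with no other coincidences, such that for all $0\le i\ne j\le n$ the sets $\mathrm{Shadow}[e_i]$ and $\mathrm{Shadow}[e_j]$ are either disjoint or one properly contains the other. Let $$\Omega_{\mathcal T}=\{a\in A : w(a)O=O \text{ and the trace of } e \text{ under } w(a) \text{ is } \mathcal T\},$$ and let $\Omega^+_{\mathcal T}$ be the set of those $a\in\Omega_{\mathcal T}$ for which the edges of $\mathcal T$ face away from the trace $O_0,\dots,O_{n+1}$ of $O$ under $w(a)$, i.e. no $O_i$ lies in any $\mathrm{Shadow}[e_j]$. (For instance, $a\in\Omega_{\mathcal T}$ belongs to $\Omega^+_{\mathcal T}$ as soon as $d(O,te)$ exceeds $1+\operatorname{diam}\{O_0,\dots,O_{n+1}\}$.) Assume that $\mu(\Omega_{\mathcal T})<\infty$. Then: 1. If $\mu(\Omega^+_{\mathcal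 T})>0$, then with respect to the probability measure $\mu|_{\Omega^+_{\mathcal T}}/\mu(\Omega^+_{\mathcal T})$ the $\mathrm{Aut}(\mathrm{Shadow}[e])$-valued random variable $a\mapsto w(a)|_{\mathrm{Shadow}[e]}$ is distributed according to the Haar probability measure on $\mathrm{Aut}(\mathrm{Shadow}[e])$. 2. For $\mu$-almost every $a\in\Omega_{\mathcal T}$ the element $w(a)$ has only finitely many fixed vertices in $\mathrm{Shadow}[e]$. -/

import Mathlib

namespace TreePaper

/-- The topology of pointwise convergence on the automorphism group of a graph
(the vertex set being discrete). -/
instance autTopologicalSpace {W : Type*} (H : SimpleGraph W) : TopologicalSpace (H ≃g H) :=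
  TopologicalSpace.induced (fun f : H ≃g H => (f : W → W))
    (@Pi.topologicalSpace W (fun _ => W) fun _ => ⊥)

/-- The Borel σ-algebra on the automorphism group of a graph. -/
instance autMeasurableSpace {W : Type*} (H : SimpleGraph W) : MeasurableSpace (H ≃g H) :=
  borel (H ≃g H)

instance autBorelSpace {W : Type*} (H : SimpleGraph W) : BorelSpace (H ≃g H) := ⟨rfl⟩

variable {V : Type*} {G : SimpleGraph V}

/-- A directed edge is positively oriented (with respect to the base vertex `O`)
if it points away from `O`. -/
def PosDart (G : SimpleGraph V) (O : V) (e : G.Dart) : Prop :=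
  G.dist O e.fst < G.dist O e.snd

/-- A legal coloring: a map from directed edges to `{0, …, d-1}` restricting to a bijection on
the star of every vertex. -/
def IsLegalColoring (G : SimpleGraph V) (d : ℕ) (c : G.Dart → Fin d) : Prop :=
  ∀ v : V, Function.Bijective fun e : {e : G.Dart // e.fst = v} => c e.val

/-- The coloring is compatible with the orientation away from `O`:
every edge that is not positively oriented gets the color `0`. -/
def CompatibleColoring (G : SimpleGraph V) (d : ℕ) (O : V) (c : G.Dart → Fin d) : Prop :=
  ∀ e : G.Dart, ¬ PosDart G O e → (c e : ℕ) = 0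

/-- A group of automorphisms acts almost freely if every nontrivial element fixes only
finitely many vertices. -/
def ActsAlmostFreely (Γ : Subgroup (G ≃g G)) : Prop :=
  ∀ γ ∈ Γ, γ ≠ 1 → {v : V | γ v = v}.Finite

/-- The image of a directed edge under an automorphism. -/
def dartMap (f : G ≃g G) (e : G.Dart) : G.Dart :=
  SimpleGraph.Hom.mapDart f.toHom e

/-- The shadow of a directed edge `e` from `oe` to `te`: the vertices `v` such that `te` lies on
the geodesic from `oe` to `v`. -/
def Shadow (G : SimpleGraph V) (e : G.Dart) : Set V :=
  {v : V | G.dist e.fst v = G.dist e.fst e.snd + G.dist e.snd v}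

theorem snd_mem_shadow (e : G.Dart) : e.snd ∈ Shadow G e := by
  simp [Shadow]

/-- The subtree spanned by `Shadow[e]`. -/
abbrev shadowGraph (G : SimpleGraph V) (e : G.Dart) : SimpleGraph (Shadow G e) :=
  G.induce (Shadow G e)

/-- The root `te` of `Shadow[e]`. -/
def shadowRoot (e : G.Dart) : Shadow G e := ⟨e.snd, snd_mem_shadow e⟩

/-- `Aut(Shadow[e])`: the automorphisms of the tree `Shadow[e]` that fix its root `te`.  As a
subgroup of the automorphism group of a graph it carries the topology of pointwise
convergence and its Borel σ-algebra. -/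
def shadowAut (e : G.Dart) : Subgroup (shadowGraph G e ≃g shadowGraph G e) where
  carrier := {f | f (shadowRoot e) = shadowRoot e}
  one_mem' := rfl
  mul_mem' := by
    intro f g hf hg
    change f (g (shadowRoot e)) = shadowRoot e
    rw [Set.mem_ofPred_eq] at hf hg
    rw [hg, hf]
  inv_mem' := by
    intro f hf
    change f.symm (shadowRoot e) = shadowRoot e
    rw [RelIso.symm_apply_eq]
    exact hf.symm

theorem dist_iso_le (f : G ≃g G) (hG : G.Connected) (x y : V) :
    G.dist (f x) (f y) ≤ G.dist x y := by
  obtain ⟨p, hp⟩ := hG.exists_walk_length_eq_dist x y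
  rw [← hp, ← SimpleGraph.Walk.length_map f.toHom p]
  exact SimpleGraph.dist_le _

theorem dist_iso (f : G ≃g G) (hG : G.Connected) (x y : V) :
    G.dist (f x) (f y) = G.dist x y := by
  refine le_antisymm (dist_iso_le f hG x y) ?_
  simpa using dist_iso_le f.symm hG (f x) (f y)

theorem fst_eq_of_dartMap {f : G ≃g G} {e : G.Dart} (h : dartMap f e = e) : f e.fst = e.fst :=
  congrArg (fun e : G.Dart => e.fst) h

theorem snd_eq_of_dartMap {f : G ≃g G} {e : G.Dart} (h : dartMap f e = e) : f e.snd = e.snd :=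
  congrArg (fun e : G.Dart => e.snd) h

theorem mem_shadow_iff (hG : G.Connected) {f : G ≃g G} {e : G.Dart} (h : dartMap f e = e)
    (v : V) : v ∈ Shadow G e ↔ f v ∈ Shadow G e := by
  have h1 := dist_iso f hG e.fst v
  have h2 := dist_iso f hG e.snd v
  rw [fst_eq_of_dartMap h] at h1
  rw [snd_eq_of_dartMap h] at h2
  simp only [Shadow, Set.mem_ofPred_eq, h1, h2]

open scoped Classical in
/-- The restriction `f|_{Shadow[e]}` as an element of `Aut(Shadow[e])`, for an automorphism `f`
with `f e = e`; the value for all other `f` is irrelevant and set to be the identity. -/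
noncomputable def restrictShadow (hG : G.Connected) (e : G.Dart) (f : G ≃g G) : shadowAut e :=
  if h : dartMap f e = e then
    ⟨{ toEquiv := f.toEquiv.subtypeEquiv (mem_shadow_iff hG h)
       map_rel_iff' := f.map_rel_iff' }, Subtype.ext (snd_eq_of_dartMap h)⟩
  else 1

/-- A letter of a word in `Γ * ℤ`: an element of `Γ`, or `t`, or `t⁻¹`. -/
inductive Letter (Γ : Subgroup (G ≃g G)) : Type _
  | elt (γ : Γ) : Letter Γ
  | t : Letter Γ
  | tinv : Letter Γ

variable {Γ : Subgroup (G ≃g G)}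

/-- The letter lies in `Γ`. -/
def Letter.InGroup : Letter Γ → Prop
  | .elt _ => True
  | .t => False
  | .tinv => False

/-- Two adjacent letters are reduced: they are not both in `Γ`, and they are neither `t t⁻¹`
nor `t⁻¹ t`. -/
def Letter.Reduced (x y : Letter Γ) : Prop :=
  ¬ (x.InGroup ∧ y.InGroup) ∧ ¬ (x = .t ∧ y = .tinv) ∧ ¬ (x = .tinv ∧ y = .t)

/-- The evaluation of a letter under the homomorphism that is the identity on `Γ` and sends
`t` to `a`. -/
def Letter.eval (a : G ≃g G) : Letter Γ → (G ≃g G)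
  | .elt γ => γ
  | .t => a
  | .tinv => a⁻¹

/-- The word `w₀ ⋯ wₙ` is in canonical form: the letters from `Γ` are nontrivial and any two
consecutive letters are reduced. -/
def CanonicalForm {n : ℕ} (w : Fin (n + 1) → Letter Γ) : Prop :=
  (∀ (i : Fin (n + 1)) (γ : Γ), w i = .elt γ → γ ≠ 1) ∧
    ∀ i : Fin n, (w i.castSucc).Reduced (w i.succ)

/-- The word `w₀ ⋯ wₙ` is in canonical form and cyclically reduced: if it has at least two
letters, then also its last and first letter are reduced. -/
def CyclicallyReduced {n : ℕ} (w : Fin (n + 1) → Letter Γ) : Prop :=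
  CanonicalForm w ∧ (0 < n → (w (Fin.last n)).Reduced (w 0))

/-- The automorphism "first `w₀(a)`, then `w₁(a)`, …, then `w_{i-1}(a)`".  (Automorphisms are
written here as maps acting from the left; the first letter of a word acts first.) -/
def partialEval {n : ℕ} (w : Fin (n + 1) → Letter Γ) (a : G ≃g G) : ℕ → (G ≃g G)
  | 0 => 1
  | i + 1 => if h : i < n + 1 then (w ⟨i, h⟩).eval a * partialEval w a i else partialEval w a i

/-- The evaluation `w(a)`. -/
def wordEval {n : ℕ} (w : Fin (n + 1) → Letter Γ) (a : G ≃g G) : G ≃g G :=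
  partialEval w a (n + 1)

/-- The trace `(e₀ = e, e₁, …, e_{n+1})` of an edge `e` under `w(a)`. -/
def edgeTrace {n : ℕ} (w : Fin (n + 1) → Letter Γ) (a : G ≃g G) (e : G.Dart) :
    Fin (n + 2) → G.Dart :=
  fun i => dartMap (partialEval w a i) e

/-- The trace `(y₀ = y, y₁, …, y_{n+1})` of a vertex `y` under `w(a)`. -/
def vertexTrace {n : ℕ} (w : Fin (n + 1) → Letter Γ) (a : G ≃g G) (y : V) : Fin (n + 2) → V :=
  fun i => partialEval w a i y

/-- `Ω_𝒯`: the automorphisms `a` such that `w(a)` fixes `O` and the trace of the edge `e` under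
`w(a)` is `𝒯`. -/
def traceSet {n : ℕ} (O : V) (w : Fin (n + 1) → Letter Γ) (e : G.Dart)
    (𝒯 : Fin (n + 2) → G.Dart) : Set (G ≃g G) :=
  {a | wordEval w a O = O ∧ edgeTrace w a e = 𝒯}

/-- `Ω⁺_𝒯`: those `a ∈ Ω_𝒯` for which all the edges of `𝒯` face away from the trace
`O₀, …, O_{n+1}` of `O` under `w(a)`, i.e. no `Oᵢ` lies in one of the shadows.  (As the complement
of a shadow is convex, it is the same to say that the edges face away from the convex hull of
the trace of `O`.) -/
def awayTraceSet {n : ℕ} (O : V) (w : Fin (n + 1) → Letter Γ) (e : G.Dart)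
    (𝒯 : Fin (n + 2) → G.Dart) : Set (G ≃g G) :=
  {a ∈ traceSet O w e 𝒯 | ∀ i j : Fin (n + 2), vertexTrace w a O i ∉ Shadow G (𝒯 j)}

end TreePaper

open TreePaper MeasureTheory

namespace TreePaper

section RootedTree

variable {V : Type*} {G : SimpleGraph V}

open scoped Classical in
/-- The neighbour of `x` that is closer to `O`; the root `O` is its own parent. -/
noncomputable def parent (G : SimpleGraph V) (O x : V) : V :=
  if h : ∃ u, G.Adj u x ∧ G.dist O x = G.dist O u + 1 then h.choose else x

/-- The children of `p` in the tree rooted at `O`. -/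
def children (G : SimpleGraph V) (O p : V) : Set V := {x | x ≠ O ∧ parent G O x = p}

theorem parent_root (O : V) : parent G O O = O := by
  unfold parent
  rw [dif_neg]
  simp

theorem exists_adj_dist (hG : G.Connected) {O x : V} (hx : x ≠ O) :
    ∃ u, G.Adj u x ∧ G.dist O x = G.dist O u + 1 := by
  obtain ⟨p, hp⟩ := hG.exists_walk_length_eq_dist x O
  cases p with
  | nil => exact absurd rfl hx
  | @cons _ u _ h q =>
    refine ⟨u, h.symm, ?_⟩
    have h1 : G.dist u O ≤ q.length := SimpleGraph.dist_le q
    have h2 : G.dist O x ≤ G.dist O u + G.dist u x := hG.dist_triangle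
    rw [SimpleGraph.dist_eq_one_iff_adj.2 h.symm] at h2
    rw [SimpleGraph.Walk.length_cons, G.dist_comm] at hp
    rw [G.dist_comm] at h1
    omega

theorem parent_spec (hG : G.Connected) {O x : V} (hx : x ≠ O) :
    G.Adj (parent G O x) x ∧ G.dist O x = G.dist O (parent G O x) + 1 := by
  have h := exists_adj_dist hG hx
  rw [parent, dif_pos h]
  exact h.choose_spec

theorem parent_unique (hT : G.IsTree) {O x u v : V} (hu : G.Adj u x)
    (hux : G.dist O x = G.dist O u + 1) (hv : G.Adj v x) (hvx : G.dist O x = G.dist O v + 1) :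
    u = v := by
  have key : ∀ {u}, G.Adj u x → G.dist O x = G.dist O u + 1 → ∃ q : G.Walk x O, q.IsPath ∧
      q.snd = u := by
    intro u hu hux
    obtain ⟨p, hp⟩ := hT.connected.exists_walk_length_eq_dist u O
    refine ⟨SimpleGraph.Walk.cons hu.symm p, ?_, by simp⟩
    apply SimpleGraph.Walk.isPath_of_length_eq_dist
    rw [SimpleGraph.Walk.length_cons, hp, G.dist_comm, ← hux, G.dist_comm]
  obtain ⟨q, hq, rfl⟩ := key hu hux
  obtain ⟨q', hq', rfl⟩ := key hv hvx
  rw [(hT.existsUnique_path x O).unique hq hq']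

theorem parent_eq (hT : G.IsTree) {O x u : V} (hu : G.Adj u x)
    (hux : G.dist O x = G.dist O u + 1) : parent G O x = u := by
  have hx : x ≠ O := by
    rintro rfl
    simp at hux
  obtain ⟨h1, h2⟩ := parent_spec hT.connected hx
  exact parent_unique hT h1 h2 hu hux

theorem adj_iff_parent (hT : G.IsTree) (O : V) {u v : V} :
    G.Adj u v ↔ v ∈ children G O u ∨ u ∈ children G O v := by
  constructor
  · intro h
    rcases hT.dist_eq_dist_add_one_of_adj O h with h1 | h1
    · right
      refine ⟨?_, parent_eq hT h.symm h1⟩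
      rintro rfl
      simp at h1
    · left
      refine ⟨?_, parent_eq hT h h1⟩
      rintro rfl
      simp at h1
  · rintro (⟨h1, rfl⟩ | ⟨h1, rfl⟩)
    · exact (parent_spec hT.connected h1).1
    · exact (parent_spec hT.connected h1).1.symm

theorem dist_of_mem_children (hG : G.Connected) {O p x : V} (hx : x ∈ children G O p) :
    G.dist O x = G.dist O p + 1 := by
  obtain ⟨h1, rfl⟩ := hx
  exact (parent_spec hG h1).2

theorem dist_parent (hG : G.Connected) (O x : V) :
    G.dist O (parent G O x) = G.dist O x - 1 := by
  by_cases hx : x = O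
  · subst hx
    simp [parent_root]
  · have := (parent_spec hG hx).2
    omega

theorem dist_parent_iterate (hG : G.Connected) (O x : V) (k : ℕ) :
    G.dist O ((parent G O)^[k] x) = G.dist O x - k := by
  induction k with
  | zero => simp
  | succ k ih =>
    rw [Function.iterate_succ_apply', dist_parent hG, ih]
    omega

theorem dist_iterate_self_le (hG : G.Connected) (O x : V) (k : ℕ) :
    G.dist ((parent G O)^[k] x) x ≤ k := by
  induction k with
  | zero => simp
  | succ k ih =>
    rw [Function.iterate_succ_apply']
    set y := (parent G O)^[k] x
    have h1 : G.dist (parent G O y) x ≤ G.dist (parent G O y) y + G.dist y x :=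
      hG.dist_triangle
    have h2 : G.dist (parent G O y) y ≤ 1 := by
      by_cases hy : y = O
      · rw [hy, parent_root]
        simp
      · exact (SimpleGraph.dist_eq_one_iff_adj.2 (parent_spec hG hy).1).le
    omega

theorem PosDart.dist_snd (hT : G.IsTree) {O : V} {e : G.Dart} (he : PosDart G O e) :
    G.dist O e.snd = G.dist O e.fst + 1 := by
  have h : G.dist O e.fst < G.dist O e.snd := he
  rcases hT.dist_eq_dist_add_one_of_adj O e.adj with h1 | h1
  · omega
  · exact h1

theorem PosDart.parent_snd (hT : G.IsTree) {O : V} {e : G.Dart} (he : PosDart G O e) :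
    parent G O e.snd = e.fst :=
  parent_eq hT e.adj (he.dist_snd hT)

theorem PosDart.ext_snd (hT : G.IsTree) {O : V} {e f : G.Dart} (he : PosDart G O e)
    (hf : PosDart G O f) (h : e.snd = f.snd) : e = f := by
  have h1 : e.fst = f.fst := by rw [← he.parent_snd hT, ← hf.parent_snd hT, h]
  exact SimpleGraph.Dart.ext _ _ (Prod.ext h1 h)

/-- The positively oriented edge that ends in `x`. -/
noncomputable def parentDart (hG : G.Connected) {O x : V} (hx : x ≠ O) : G.Dart :=
  ⟨(parent G O x, x), (parent_spec hG hx).1⟩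

theorem posDart_parentDart (hG : G.Connected) {O x : V} (hx : x ≠ O) :
    PosDart G O (parentDart hG hx) := by
  have := (parent_spec hG hx).2
  change G.dist O (parent G O x) < G.dist O x
  omega

theorem le_dist_of_walk (hT : G.IsTree) {O : V} {e : G.Dart} (he : PosDart G O e) {v : V}
    (p : G.Walk v e.snd) (hv : ∀ k, (parent G O)^[k] v ≠ e.snd) :
    G.dist v e.fst + 1 ≤ p.length := by
  have key : ∀ {v y : V} (p : G.Walk v y), y = e.snd → (∀ k, (parent G O)^[k] v ≠ e.snd) →
      G.dist v e.fst + 1 ≤ p.length := by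
    intro v y p
    induction p with
    | nil =>
      intro h hv
      exact absurd h (hv 0)
    | @cons v u y h q ih =>
      intro hy hv
      rw [SimpleGraph.Walk.length_cons]
      by_cases hu : ∀ k, (parent G O)^[k] u ≠ e.snd
      · have h1 := ih hy hu
        have h2 : G.dist v e.fst ≤ G.dist v u + G.dist u e.fst := hT.connected.dist_triangle
        rw [SimpleGraph.dist_eq_one_iff_adj.2 h] at h2
        omega
      · push Not at hu
        obtain ⟨k, hk⟩ := hu
        rcases (adj_iff_parent hT O).1 h with ⟨h1, h2⟩ | ⟨h1, h2⟩
        · cases k with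
          | zero =>
            have h3 : u = e.snd := hk
            rw [h3, he.parent_snd hT] at h2
            rw [h2]
            simp
          | succ k =>
            rw [Function.iterate_succ_apply, h2] at hk
            exact absurd hk (hv k)
        · have := hv (k + 1)
          rw [Function.iterate_succ_apply, h2] at this
          exact absurd hk this
  exact key p rfl hv

theorem mem_shadow_iff_iterate (hT : G.IsTree) {O : V} {e : G.Dart} (he : PosDart G O e) {v : V} :
    v ∈ Shadow G e ↔ ∃ k, (parent G O)^[k] v = e.snd := by
  have hadj : G.dist e.fst e.snd = 1 := SimpleGraph.dist_eq_one_iff_adj.2 e.adj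
  have hG := hT.connected
  constructor
  · intro hv
    by_contra! hk
    obtain ⟨p, hp⟩ := hG.exists_walk_length_eq_dist v e.snd
    have h1 := le_dist_of_walk hT he p hk
    have h2 : G.dist e.fst v = G.dist e.fst e.snd + G.dist e.snd v := hv
    rw [hp, G.dist_comm, h2, G.dist_comm (u := v)] at h1
    omega
  · rintro ⟨k, hk⟩
    have h1 := dist_iterate_self_le hG O v k
    have h2 := dist_parent_iterate hG O v k
    rw [hk] at h1 h2
    have h3 := he.dist_snd hT
    have h4 : G.dist O v ≤ G.dist O e.fst + G.dist e.fst v := hG.dist_triangle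
    have h5 : G.dist e.fst v ≤ G.dist e.fst e.snd + G.dist e.snd v := hG.dist_triangle
    change G.dist e.fst v = G.dist e.fst e.snd + G.dist e.snd v
    omega

theorem dist_of_mem_shadow (hT : G.IsTree) {O : V} {e : G.Dart} (he : PosDart G O e) {v : V}
    (hv : v ∈ Shadow G e) : G.dist O v = G.dist O e.snd + G.dist e.snd v := by
  have hG := hT.connected
  obtain ⟨k, hk⟩ := (mem_shadow_iff_iterate hT he).1 hv
  have h1 := dist_iterate_self_le hG O v k
  have h2 := dist_parent_iterate hG O v k
  rw [hk] at h1 h2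
  have h3 := he.dist_snd hT
  have h4 : G.dist O v ≤ G.dist O e.snd + G.dist e.snd v := hG.dist_triangle
  omega

theorem iterate_of_mem_shadow (hT : G.IsTree) {O : V} {e : G.Dart} (he : PosDart G O e) {v : V}
    (hv : v ∈ Shadow G e) : (parent G O)^[G.dist O v - G.dist O e.snd] v = e.snd := by
  obtain ⟨k, hk⟩ := (mem_shadow_iff_iterate hT he).1 hv
  have h2 := dist_parent_iterate hT.connected O v k
  rw [hk] at h2
  have h3 := he.dist_snd hT
  rw [show G.dist O v - G.dist O e.snd = k by omega, hk]

theorem PosDart.eq_of_mem_shadow (hT : G.IsTree) {O : V} {e f : G.Dart} (he : PosDart G O e)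
    (hf : PosDart G O f) (h : G.dist O e.snd = G.dist O f.snd) {v : V} (hve : v ∈ Shadow G e)
    (hvf : v ∈ Shadow G f) : e = f := by
  apply he.ext_snd hT hf
  rw [← iterate_of_mem_shadow hT he hve, ← iterate_of_mem_shadow hT hf hvf, h]

theorem root_notMem_shadow (hT : G.IsTree) {O : V} {e : G.Dart} (he : PosDart G O e) :
    O ∉ Shadow G e := by
  intro h
  have h1 := dist_of_mem_shadow hT he h
  have h2 := he.dist_snd hT
  simp at h1
  omega

theorem fst_notMem_shadow (e : G.Dart) : e.fst ∉ Shadow G e := by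
  intro h
  have h1 : G.dist e.fst e.fst = G.dist e.fst e.snd + G.dist e.snd e.fst := h
  rw [SimpleGraph.dist_eq_one_iff_adj.2 e.adj] at h1
  simp at h1
  omega

theorem mem_shadow_of_parent (hT : G.IsTree) {O : V} {e : G.Dart} (he : PosDart G O e) {v : V}
    (hv : parent G O v ∈ Shadow G e) : v ∈ Shadow G e := by
  rw [mem_shadow_iff_iterate hT he] at hv ⊢
  obtain ⟨k, hk⟩ := hv
  exact ⟨k + 1, hk⟩

theorem parent_mem_shadow (hT : G.IsTree) {O : V} {e : G.Dart} (he : PosDart G O e) {v : V}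
    (hv : v ∈ Shadow G e) (hne : v ≠ e.snd) : parent G O v ∈ Shadow G e := by
  rw [mem_shadow_iff_iterate hT he] at hv ⊢
  obtain ⟨k, hk⟩ := hv
  cases k with
  | zero => exact absurd hk hne
  | succ k => exact ⟨k, hk⟩

theorem eq_of_adj_shadow (hT : G.IsTree) {O : V} {e : G.Dart} (he : PosDart G O e) {u v : V}
    (hu : u ∈ Shadow G e) (hv : v ∉ Shadow G e) (h : G.Adj u v) : u = e.snd ∧ v = e.fst := by
  rcases (adj_iff_parent hT O).1 h with ⟨h1, rfl⟩ | ⟨h1, rfl⟩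
  · exact absurd (mem_shadow_of_parent hT he hu) hv
  · have : u = e.snd := by
      by_contra hne
      exact hv (parent_mem_shadow hT he hu hne)
    exact ⟨this, by rw [this, he.parent_snd hT]⟩

theorem finite_ball [G.LocallyFinite] (hG : G.Connected) (y : V) (r : ℕ) :
    {v | G.dist y v ≤ r}.Finite := by
  induction r with
  | zero =>
    refine (Set.finite_singleton y).subset ?_
    intro v hv
    have : G.dist y v ≤ 0 := hv
    exact (hG.dist_eq_zero_iff.1 (Nat.le_zero.1 this)).symm
  | succ r ih =>
    refine (ih.union (ih.biUnion fun u _ => (G.neighborSet u).toFinite)).subset ?_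
    intro v hv
    have hv : G.dist y v ≤ r + 1 := hv
    by_cases h : G.dist y v ≤ r
    · exact Or.inl h
    · right
      have hne : v ≠ y := by
        rintro rfl
        simp at h
      obtain ⟨u, hu, hd⟩ := exists_adj_dist hG hne
      simp only [Set.mem_iUnion]
      refine ⟨u, ?_, hu⟩
      change G.dist y u ≤ r
      omega

theorem countable_vertices [G.LocallyFinite] (hG : G.Connected) : Countable V := by
  obtain ⟨y⟩ := hG.nonempty
  have : (Set.univ : Set V) = ⋃ r : ℕ, {v | G.dist y v ≤ r} := by
    ext v
    simp only [Set.mem_univ, Set.mem_iUnion, true_iff]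
    exact ⟨_, le_refl (G.dist y v)⟩
  rw [← Set.countable_univ_iff, this]
  exact Set.countable_iUnion fun r => (finite_ball hG y r).countable

theorem countable_darts [Countable V] : Countable G.Dart :=
  Function.Injective.countable (f := fun e : G.Dart => e.toProd)
    fun _ _ h => SimpleGraph.Dart.ext _ _ h

theorem children_root (hT : G.IsTree) (O : V) : children G O O = G.neighborSet O := by
  ext x
  rw [SimpleGraph.mem_neighborSet, adj_iff_parent hT O]
  constructor
  · exact Or.inl
  · rintro (h | h)
    · exact h
    · exact absurd rfl h.1

theorem insert_parent_children (hT : G.IsTree) {O p : V} (hp : p ≠ O) :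
    insert (parent G O p) (children G O p) = G.neighborSet p := by
  ext x
  rw [SimpleGraph.mem_neighborSet, adj_iff_parent hT O, Set.mem_insert_iff, or_comm]
  refine or_congr Iff.rfl ?_
  constructor
  · rintro rfl
    exact ⟨hp, rfl⟩
  · rintro ⟨-, h⟩
    exact h.symm

theorem finite_children [G.LocallyFinite] (hT : G.IsTree) (O p : V) :
    (children G O p).Finite :=
  (G.neighborSet p).toFinite.subset fun _ hx => (adj_iff_parent hT O).2 (Or.inl hx)

theorem ncard_neighborSet [G.LocallyFinite] {d : ℕ} (hreg : G.IsRegularOfDegree d) (p : V) :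
    (G.neighborSet p).ncard = d := by
  rw [← hreg p, Set.ncard_eq_toFinset_card', ← SimpleGraph.card_neighborSet_eq_degree,
    Set.toFinset_card]

theorem ncard_children [G.LocallyFinite] (hT : G.IsTree) {d : ℕ} (hreg : G.IsRegularOfDegree d)
    {O p : V} (hp : p ≠ O) : (children G O p).ncard = d - 1 := by
  have h := ncard_neighborSet hreg p
  rw [← insert_parent_children hT hp, Set.ncard_insert_of_notMem _ (finite_children hT O p)] at h
  · omega
  · intro hm
    have h1 := dist_of_mem_children hT.connected hm
    rw [dist_parent hT.connected] at h1
    omega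

theorem ncard_children_eq [G.LocallyFinite] (hT : G.IsTree) {d : ℕ}
    (hreg : G.IsRegularOfDegree d) {O O' p q : V} (h : p = O ↔ q = O') :
    (children G O p).ncard = (children G O' q).ncard := by
  by_cases hp : p = O
  · have hq := h.1 hp
    subst hp hq
    rw [children_root hT, children_root hT, ncard_neighborSet hreg, ncard_neighborSet hreg]
  · rw [ncard_children hT hreg hp, ncard_children hT hreg (fun hq => hp (h.2 hq))]

theorem nonempty_children [G.LocallyFinite] (hT : G.IsTree) {d : ℕ} (hd : 3 ≤ d)
    (hreg : G.IsRegularOfDegree d) (O p : V) : (children G O p).Nonempty := by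
  apply Set.nonempty_of_ncard_ne_zero
  by_cases hp : p = O
  · subst hp
    rw [children_root hT, ncard_neighborSet hreg]
    omega
  · rw [ncard_children hT hreg hp]
    omega

theorem infinite_vertices [G.LocallyFinite] (hT : G.IsTree) {d : ℕ} (hd : 3 ≤ d)
    (hreg : G.IsRegularOfDegree d) (O : V) : Infinite V := by
  have h : ∀ r : ℕ, ∃ v, G.dist O v = r := by
    intro r
    induction r with
    | zero => exact ⟨O, by simp⟩
    | succ r ih =>
      obtain ⟨v, hv⟩ := ih
      obtain ⟨x, hx⟩ := nonempty_children hT hd hreg O v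
      exact ⟨x, by rw [dist_of_mem_children hT.connected hx, hv]⟩
  choose f hf using h
  refine Infinite.of_injective f fun r s hrs => ?_
  rw [← hf r, ← hf s, hrs]

/-- Bijections between the sets of children assemble to an automorphism of the tree. -/
theorem exists_automorphism (hT : G.IsTree) (O O' : V) (B : V → V → V → V)
    (hB : ∀ p q, (p = O ↔ q = O') → Set.BijOn (B p q) (children G O p) (children G O' q)) :
    ∃ φ : G ≃g G, φ O = O' ∧ ∀ x, x ≠ O → φ x = B (parent G O x) (φ (parent G O x)) x := by
  classical
  have hG := hT.connected
  obtain ⟨φ, hφ0, hφ⟩ : ∃ φ : V → V, φ O = O' ∧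
      ∀ x, x ≠ O → φ x = B (parent G O x) (φ (parent G O x)) x := by
    have hlt : ∀ x, x ≠ O → G.dist O (parent G O x) < G.dist O x := fun x hx => by
      have := (parent_spec hG hx).2
      omega
    let F : (x : V) → ((y : V) → G.dist O y < G.dist O x → V) → V := fun x rec =>
      if hx : x = O then O' else B (parent G O x) (rec (parent G O x) (hlt x hx)) x
    let wf := (measure fun x : V => G.dist O x).wf
    refine ⟨wf.fix F, ?_, ?_⟩
    · rw [wf.fix_eq]
      simp [F]
    · intro x hx
      rw [wf.fix_eq]
      simp only [F, dif_neg hx]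
  have hlev : ∀ r x, G.dist O x = r → G.dist O' (φ x) = r ∧
      (x ≠ O → φ x ∈ children G O' (φ (parent G O x))) := by
    intro r
    induction r with
    | zero =>
      intro x hx
      have : O = x := hG.dist_eq_zero_iff.1 hx
      subst this
      refine ⟨by rw [hφ0]; simp, fun h => absurd rfl h⟩
    | succ r ih =>
      intro x hx
      have hxO : x ≠ O := by
        rintro rfl
        simp at hx
      obtain ⟨h1, h2⟩ := parent_spec hG hxO
      have h3 := (ih (parent G O x) (by omega)).1
      have hiff : parent G O x = O ↔ φ (parent G O x) = O' := by
        rw [eq_comm, ← hG.dist_eq_zero_iff, eq_comm (b := O'), ← hG.dist_eq_zero_iff, h3]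
        omega
      have h4 : φ x ∈ children G O' (φ (parent G O x)) := by
        rw [hφ x hxO]
        exact (hB _ _ hiff).mapsTo ⟨hxO, rfl⟩
      refine ⟨?_, fun _ => h4⟩
      rw [dist_of_mem_children hG h4, h3]
  have hdist : ∀ x, G.dist O' (φ x) = G.dist O x := fun x => (hlev _ x rfl).1
  have hiff : ∀ x, x = O ↔ φ x = O' := by
    intro x
    rw [eq_comm, ← hG.dist_eq_zero_iff, eq_comm (b := O'), ← hG.dist_eq_zero_iff, hdist]
  have hpar : ∀ x, parent G O' (φ x) = φ (parent G O x) := by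
    intro x
    by_cases hx : x = O
    · rw [hx, parent_root, hφ0, parent_root]
    · exact ((hlev _ x rfl).2 hx).2
  have hinj : Function.Injective φ := by
    have key : ∀ r x y, G.dist O x = r → φ x = φ y → x = y := by
      intro r
      induction r with
      | zero =>
        intro x y hx hxy
        have : O = x := hG.dist_eq_zero_iff.1 hx
        subst this
        rw [hφ0] at hxy
        exact ((hiff y).2 hxy.symm).symm
      | succ r ih =>
        intro x y hx hxy
        have hxO : x ≠ O := by
          rintro rfl
          simp at hx
        have hyO : y ≠ O := by
          intro h
          rw [hiff, ← hxy, ← hiff] at h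
          exact hxO h
        have h1 : parent G O x = parent G O y := by
          apply ih
          · have := (parent_spec hG hxO).2
            omega
          · rw [← hpar, ← hpar, hxy]
        rw [hφ x hxO, hφ y hyO, ← h1] at hxy
        exact (hB _ _ (hiff _)).injOn ⟨hxO, rfl⟩ ⟨hyO, h1.symm⟩ hxy
    exact fun x y => key _ x y rfl
  have hsurj : Function.Surjective φ := by
    have key : ∀ r y, G.dist O' y = r → ∃ x, φ x = y := by
      intro r
      induction r with
      | zero =>
        intro y hy
        exact ⟨O, by rw [hφ0]; exact hG.dist_eq_zero_iff.1 hy⟩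
      | succ r ih =>
        intro y hy
        have hyO : y ≠ O' := by
          rintro rfl
          simp at hy
        obtain ⟨p, hp⟩ := ih (parent G O' y) (by have := (parent_spec hG hyO).2; omega)
        have hy' : y ∈ children G O' (φ p) := ⟨hyO, hp.symm⟩
        obtain ⟨x, ⟨hxO, hx⟩, hxy⟩ := (hB _ _ (hiff p)).surjOn hy'
        refine ⟨x, ?_⟩
        rw [hφ x hxO, hx, hxy]
    exact fun y => key _ y rfl
  have hchild : ∀ x p, φ x ∈ children G O' (φ p) ↔ x ∈ children G O p := by
    intro x p
    unfold children
    simp only [Set.mem_ofPred_eq]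
    rw [hpar, hinj.eq_iff, ne_eq, ne_eq, ← hiff]
  refine ⟨⟨Equiv.ofBijective φ ⟨hinj, hsurj⟩, ?_⟩, hφ0, hφ⟩
  intro u v
  change G.Adj (φ u) (φ v) ↔ G.Adj u v
  rw [adj_iff_parent hT O', adj_iff_parent hT O, hchild, hchild]

theorem exists_bijOn_children [G.LocallyFinite] (hT : G.IsTree) {d : ℕ}
    (hreg : G.IsRegularOfDegree d) {O O' p q : V} (h : p = O ↔ q = O') :
    ∃ b : V → V, Set.BijOn b (children G O p) (children G O' q) := by
  classical
  have hc := ncard_children_eq hT hreg h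
  have := (finite_children hT O p).to_subtype
  have := (finite_children hT O' q).to_subtype
  obtain ⟨b⟩ : Nonempty (children G O p ≃ children G O' q) := by
    apply Finite.card_eq.1
    rwa [Nat.card_coe_set_eq, Nat.card_coe_set_eq]
  refine ⟨fun x => if hx : x ∈ children G O p then b ⟨x, hx⟩ else x, ?_, ?_, ?_⟩
  · intro x hx
    simp only [dif_pos hx]
    exact (b ⟨x, hx⟩).2
  · intro x hx y hy hxy
    simp only [dif_pos hx, dif_pos hy] at hxy
    simpa using b.injective (Subtype.ext hxy)
  · intro y hy
    refine ⟨b.symm ⟨y, hy⟩, (b.symm ⟨y, hy⟩).2, ?_⟩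
    simp

/-- The automorphism group of a regular tree is transitive on vertices. -/
theorem exists_automorphism_apply_eq [G.LocallyFinite] (hT : G.IsTree) {d : ℕ}
    (hreg : G.IsRegularOfDegree d) (x y : V) : ∃ φ : G ≃g G, φ x = y := by
  classical
  choose! b hb using fun p q => exists_bijOn_children (p := p) (q := q) (O := x) (O' := y) hT hreg
  obtain ⟨φ, h, -⟩ := exists_automorphism hT x y b hb
  exact ⟨φ, h⟩

/-- Permutations of the children of the vertices in a set `Q` of vertices of the same level
extend to an automorphism that is trivial on the other vertices up to the next level. -/
theorem exists_automorphism_permuting [G.LocallyFinite] (hT : G.IsTree) {d : ℕ}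
    (hreg : G.IsRegularOfDegree d) (O : V) (r : ℕ) (β : V → V → V)
    (hβ : ∀ p, G.dist O p = r → Set.BijOn (β p) (children G O p) (children G O p)) :
    ∃ φ : G ≃g G, (∀ x, G.dist O x ≤ r → φ x = x) ∧
      ∀ p x, G.dist O p = r → x ∈ children G O p → φ x = β p x := by
  classical
  have hG := hT.connected
  choose! b hb using fun p q => exists_bijOn_children (p := p) (q := q) (O := O) (O' := O) hT hreg
  obtain ⟨φ, h0, h⟩ := exists_automorphism hT O O
    (fun p q => if q = p then (if G.dist O p = r then β p else id) else b p q) (by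
      intro p q hpq
      split_ifs with h1 h2
      · subst h1
        exact hβ _ h2
      · subst h1
        exact Set.bijOn_id _
      · exact hb p q hpq)
  have hfix : ∀ k x, G.dist O x = k → k ≤ r → φ x = x := by
    intro k
    induction k with
    | zero =>
      intro x hx _
      rw [← hG.dist_eq_zero_iff.1 hx, h0]
    | succ k ih =>
      intro x hx hk
      have hxO : x ≠ O := by
        rintro rfl
        simp at hx
      have h1 := (parent_spec hG hxO).2
      rw [h x hxO, ih (parent G O x) (by omega) (by omega), if_pos rfl, if_neg (by omega)]
      rfl
  refine ⟨φ, fun x hx => hfix _ x rfl hx, ?_⟩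
  rintro p x hp ⟨hxO, rfl⟩
  rw [h x hxO, hfix _ _ hp le_rfl, if_pos rfl, if_pos hp]

end RootedTree

open MeasureTheory

section Pointwise

variable {X W : Type*}

theorem countable_range_cylinder [Countable W] (ev : X → W → W) {F : Set W} (hF : F.Finite) :
    (Set.range fun x => {y | ∀ v ∈ F, ev y v = ev x v}).Countable := by
  have := hF.to_subtype
  refine ((Set.to_countable (Set.univ : Set (F → W))).image
    fun g => {y | ∀ v : F, ev y v = g v}).mono ?_
  rintro _ ⟨x, rfl⟩
  refine ⟨fun v => ev x v, Set.mem_univ _, ?_⟩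
  ext y
  simp

variable [tX : TopologicalSpace X] {ev : X → W → W}

theorem isOpen_eval_eq
    (hX : tX = TopologicalSpace.induced ev (@Pi.topologicalSpace W (fun _ => W) fun _ => ⊥))
    (v y : W) : IsOpen {x | ev x v = y} := by
  let _ : TopologicalSpace W := ⊥
  have : DiscreteTopology W := ⟨rfl⟩
  have hc : Continuous ev := by
    rw [hX]
    exact continuous_induced_dom
  exact (isOpen_discrete ({y} : Set W)).preimage ((continuous_apply v).comp hc)

theorem isOpen_eval_eq_on
    (hX : tX = TopologicalSpace.induced ev (@Pi.topologicalSpace W (fun _ => W) fun _ => ⊥))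
    {F : Set W} (hF : F.Finite) (g : W → W) : IsOpen {x | ∀ v ∈ F, ev x v = g v} := by
  have : {x | ∀ v ∈ F, ev x v = g v} = ⋂ v ∈ F, {x | ev x v = g v} := by
    ext x
    simp
  rw [this]
  exact hF.isOpen_biInter fun v _ => isOpen_eval_eq hX v (g v)

theorem exists_finite_of_isOpen
    (hX : tX = TopologicalSpace.induced ev (@Pi.topologicalSpace W (fun _ => W) fun _ => ⊥))
    {U : Set X} (hU : IsOpen U) {x : X} (hx : x ∈ U) :
    ∃ F : Set W, F.Finite ∧ ∀ y, (∀ v ∈ F, ev y v = ev x v) → y ∈ U := by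
  let _ : TopologicalSpace W := ⊥
  have : DiscreteTopology W := ⟨rfl⟩
  rw [hX, isOpen_induced_iff] at hU
  obtain ⟨U', hU', rfl⟩ := hU
  obtain ⟨I, u, hu, hsub⟩ := isOpen_pi_iff.1 hU' (ev x) hx
  refine ⟨I, I.finite_toSet, fun y hy => hsub ?_⟩
  intro v hv
  rw [hy v hv]
  exact (hu v hv).2

theorem continuous_of_isOpen_eval {Y : Type*} [TopologicalSpace Y] {f : Y → X}
    (hX : tX = TopologicalSpace.induced ev (@Pi.topologicalSpace W (fun _ => W) fun _ => ⊥))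
    (hf : ∀ v y, IsOpen {z | ev (f z) v = y}) : Continuous f := by
  let _ : TopologicalSpace W := ⊥
  have : DiscreteTopology W := ⟨rfl⟩
  rw [hX, continuous_induced_rng]
  refine continuous_pi fun v => ?_
  rw [continuous_discrete_rng]
  exact fun y => hf v y

variable [MeasurableSpace X]

/-- Two Borel measures on a space with the topology of pointwise convergence agree if they agree
on the cylinder sets over an exhaustion by finite sets. -/
theorem ext_of_cylinders [BorelSpace X] [Countable W]
    (hX : tX = TopologicalSpace.induced ev (@Pi.topologicalSpace W (fun _ => W) fun _ => ⊥))
    {B : ℕ → Set W} (hBfin : ∀ r, (B r).Finite) (hBmono : Monotone B) (hBcover : ∀ v, ∃ r, v ∈ B r)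
    {μ ν : Measure X} (hfin : ∀ r x, μ {y | ∀ v ∈ B r, ev y v = ev x v} ≠ ⊤)
    (h : ∀ r x, μ {y | ∀ v ∈ B r, ev y v = ev x v} = ν {y | ∀ v ∈ B r, ev y v = ev x v}) :
    μ = ν := by
  set S : Set (Set X) := ⋃ r, Set.range fun x => {y | ∀ v ∈ B r, ev y v = ev x v} with hS
  have hScount : S.Countable := Set.countable_iUnion fun r => countable_range_cylinder ev (hBfin r)
  have hSmem : ∀ r x, {y | ∀ v ∈ B r, ev y v = ev x v} ∈ S := fun r x =>
    Set.mem_iUnion.2 ⟨r, x, rfl⟩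
  have hbasis : ∀ U : Set X, IsOpen U → ∀ x ∈ U, ∃ r, {y | ∀ v ∈ B r, ev y v = ev x v} ⊆ U := by
    intro U hU x hx
    obtain ⟨F, hF, hFU⟩ := exists_finite_of_isOpen hX hU hx
    choose r hr using hBcover
    obtain ⟨M, hM⟩ := (hF.image r).bddAbove
    refine ⟨M, fun y hy => hFU y fun v hv => hy v (hBmono (hM ⟨v, hv, rfl⟩) (hr v))⟩
  refine Measure.ext_of_generateFrom_of_cover_subset (S := S) (T := S) ?_ ?_ le_rfl hScount ?_ ?_ ?_
  · apply le_antisymm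
    · rw [BorelSpace.measurable_eq (α := X)]
      refine MeasurableSpace.generateFrom_le fun U hU => ?_
      have : U = ⋃₀ {s ∈ S | s ⊆ U} := by
        apply Set.Subset.antisymm
        · intro x hx
          obtain ⟨r, hr⟩ := hbasis U hU x hx
          exact ⟨_, ⟨hSmem r x, hr⟩, fun v _ => rfl⟩
        · exact Set.sUnion_subset fun s hs => hs.2
      rw [this]
      refine MeasurableSet.sUnion (hScount.mono fun s hs => hs.1) fun s hs => ?_
      exact MeasurableSpace.measurableSet_generateFrom hs.1
    · refine MeasurableSpace.generateFrom_le fun s hs => ?_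
      obtain ⟨r, x, rfl⟩ := Set.mem_iUnion.1 hs
      exact (isOpen_eval_eq_on hX (hBfin r) (ev x)).measurableSet
  · intro s hs t ht hst
    obtain ⟨r, x, rfl⟩ := Set.mem_iUnion.1 hs
    obtain ⟨r', x', rfl⟩ := Set.mem_iUnion.1 ht
    obtain ⟨z, hz, hz'⟩ := hst
    have : {y | ∀ v ∈ B r, ev y v = ev x v} ∩ {y | ∀ v ∈ B r', ev y v = ev x' v} =
        {y | ∀ v ∈ B (max r r'), ev y v = ev z v} := by
      ext y
      constructor
      · rintro ⟨hy, hy'⟩ v hv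
        rcases le_total r r' with hr | hr
        · rw [max_eq_right hr] at hv
          rw [hy' v hv, hz' v hv]
        · rw [max_eq_left hr] at hv
          rw [hy v hv, hz v hv]
      · intro hy
        exact ⟨fun v hv => by rw [hy v (hBmono (le_max_left _ _) hv), hz v hv],
          fun v hv => by rw [hy v (hBmono (le_max_right _ _) hv), hz' v hv]⟩
    dsimp only
    rw [this]
    exact hSmem _ z
  · exact Set.eq_univ_of_forall fun x => ⟨_, hSmem 0 x, fun v _ => rfl⟩
  · intro s hs
    obtain ⟨r, x, rfl⟩ := Set.mem_iUnion.1 hs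
    exact hfin r x
  · intro s hs
    obtain ⟨r, x, rfl⟩ := Set.mem_iUnion.1 hs
    exact h r x

theorem isOpenPosMeasure_of_cylinders [Countable W]
    (hX : tX = TopologicalSpace.induced ev (@Pi.topologicalSpace W (fun _ => W) fun _ => ⊥))
    {B : ℕ → Set W} (hBfin : ∀ r, (B r).Finite) (hBmono : Monotone B) (hBcover : ∀ v, ∃ r, v ∈ B r)
    {μ : Measure X} (hμ : μ ≠ 0)
    (h : ∀ r x x', μ {y | ∀ v ∈ B r, ev y v = ev x v} = μ {y | ∀ v ∈ B r, ev y v = ev x' v}) :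
    μ.IsOpenPosMeasure := by
  refine ⟨fun U hU ⟨x, hx⟩ h0 => hμ ?_⟩
  obtain ⟨F, hF, hFU⟩ := exists_finite_of_isOpen hX hU hx
  choose r hr using hBcover
  obtain ⟨M, hM⟩ := (hF.image r).bddAbove
  have hzero : μ {y | ∀ v ∈ B M, ev y v = ev x v} = 0 := measure_mono_null
    (fun y hy => hFU y fun v hv => hy v (hBmono (hM ⟨v, hv, rfl⟩) (hr v))) h0
  rw [← Measure.measure_univ_eq_zero]
  have : (Set.univ : Set X) = ⋃₀ Set.range fun x => {y | ∀ v ∈ B M, ev y v = ev x v} := by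
    refine (Set.eq_univ_of_forall fun x => ?_).symm
    exact ⟨{y | ∀ v ∈ B M, ev y v = ev x v}, ⟨x, rfl⟩, fun v _ => rfl⟩
  rw [this, measure_sUnion_null_iff (countable_range_cylinder ev (hBfin M))]
  rintro _ ⟨x', rfl⟩
  rw [← hzero]
  exact h M x' x

end Pointwise

section AutomorphismGroup

variable {W : Type*} {H : SimpleGraph W}

theorem autTopologicalSpace_eq : autTopologicalSpace H =
    TopologicalSpace.induced (fun f : H ≃g H => (f : W → W))
      (@Pi.topologicalSpace W (fun _ => W) fun _ => ⊥) := rfl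

theorem subgroup_topology_eq (K : Subgroup (H ≃g H)) :
    (inferInstance : TopologicalSpace K) =
    TopologicalSpace.induced (fun f : K => (f.1 : W → W))
      (@Pi.topologicalSpace W (fun _ => W) fun _ => ⊥) :=
  induced_compose

theorem isOpen_apply_eq (v y : W) : IsOpen {f : H ≃g H | f v = y} :=
  isOpen_eval_eq autTopologicalSpace_eq v y

instance isTopologicalGroup_aut : IsTopologicalGroup (H ≃g H) where
  continuous_mul := by
    refine continuous_of_isOpen_eval autTopologicalSpace_eq fun v y => ?_
    have : {z : (H ≃g H) × (H ≃g H) | (z.1 * z.2) v = y} =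
        ⋃ u, {f : H ≃g H | f u = y} ×ˢ {g : H ≃g H | g v = u} := by
      ext z
      simp [RelIso.mul_apply]
    rw [this]
    exact isOpen_iUnion fun u => (isOpen_apply_eq u y).prod (isOpen_apply_eq v u)
  continuous_inv := by
    refine continuous_of_isOpen_eval autTopologicalSpace_eq fun v y => ?_
    have : {f : H ≃g H | f⁻¹ v = y} = {f : H ≃g H | f y = v} := by
      ext f
      constructor
      · rintro rfl
        exact RelIso.apply_inv_self f v
      · rintro rfl
        exact RelIso.inv_apply_self f y
    rw [this]
    exact isOpen_apply_eq y v

end AutomorphismGroup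

section WordMaps

variable {V : Type*} {G : SimpleGraph V} {Γ : Subgroup (G ≃g G)} {n : ℕ}

theorem Letter.continuous_eval (x : Letter Γ) : Continuous fun a : G ≃g G => x.eval a := by
  cases x with
  | elt γ => exact continuous_const
  | t => exact continuous_id
  | tinv => exact continuous_inv

theorem continuous_partialEval (w : Fin (n + 1) → Letter Γ) (i : ℕ) :
    Continuous fun a : G ≃g G => partialEval w a i := by
  induction i with
  | zero => exact continuous_const
  | succ i ih =>
    simp only [partialEval]
    split_ifs with h
    · exact ((w ⟨i, h⟩).continuous_eval).mul ih
    · exact ih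

theorem isOpen_partialEval_eq (w : Fin (n + 1) → Letter Γ) (i : ℕ) (v y : V) :
    IsOpen {a : G ≃g G | partialEval w a i v = y} :=
  (isOpen_apply_eq v y).preimage (continuous_partialEval w i)

theorem isOpen_dartMap_eq (e f : G.Dart) : IsOpen {a : G ≃g G | dartMap a e = f} := by
  have : {a : G ≃g G | dartMap a e = f} =
      {a : G ≃g G | a e.fst = f.fst} ∩ {a : G ≃g G | a e.snd = f.snd} := by
    ext a
    constructor
    · rintro rfl
      exact ⟨rfl, rfl⟩
    · rintro ⟨h1, h2⟩
      exact SimpleGraph.Dart.ext _ _ (Prod.ext h1 h2)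
  rw [this]
  exact (isOpen_apply_eq _ _).inter (isOpen_apply_eq _ _)

theorem isClosed_dartMap_eq (e f : G.Dart) : IsClosed {a : G ≃g G | dartMap a e = f} := by
  rw [← isOpen_compl_iff]
  have : {a : G ≃g G | dartMap a e = f}ᶜ = ⋃ f' ∈ {f' | f' ≠ f}, {a | dartMap a e = f'} := by
    ext a
    simp
  rw [this]
  exact isOpen_biUnion fun f' _ => isOpen_dartMap_eq e f'

theorem isOpen_edgeTrace_eq (w : Fin (n + 1) → Letter Γ) (e : G.Dart) (𝒯 : Fin (n + 2) → G.Dart) :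
    IsOpen {a : G ≃g G | edgeTrace w a e = 𝒯} := by
  have : {a : G ≃g G | edgeTrace w a e = 𝒯} =
      ⋂ i : Fin (n + 2), {a | dartMap (partialEval w a i) e = 𝒯 i} := by
    ext a
    simp [funext_iff, edgeTrace]
  rw [this]
  exact isOpen_iInter_of_finite fun i =>
    (isOpen_dartMap_eq e (𝒯 i)).preimage (continuous_partialEval w i)

theorem isOpen_vertexTrace_mem (w : Fin (n + 1) → Letter Γ) (y : V) (P : Set (Fin (n + 2) → V)) :
    IsOpen {a : G ≃g G | vertexTrace w a y ∈ P} := by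
  have : {a : G ≃g G | vertexTrace w a y ∈ P} =
      ⋃ p ∈ P, ⋂ i : Fin (n + 2), {a | partialEval w a i y = p i} := by
    ext a
    simp only [Set.mem_ofPred_eq, Set.mem_iUnion, Set.mem_iInter]
    constructor
    · exact fun h => ⟨_, h, fun i => rfl⟩
    · rintro ⟨p, hp, h⟩
      rwa [show vertexTrace w a y = p from funext h]
  rw [this]
  exact isOpen_biUnion fun p _ => isOpen_iInter_of_finite fun i => isOpen_partialEval_eq w i y (p i)

theorem isOpen_traceSet (O : V) (w : Fin (n + 1) → Letter Γ) (e : G.Dart)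
    (𝒯 : Fin (n + 2) → G.Dart) : IsOpen (traceSet O w e 𝒯) :=
  (isOpen_partialEval_eq w (n + 1) O O).inter (isOpen_edgeTrace_eq w e 𝒯)

theorem isOpen_awayTraceSet (O : V) (w : Fin (n + 1) → Letter Γ) (e : G.Dart)
    (𝒯 : Fin (n + 2) → G.Dart) : IsOpen (awayTraceSet O w e 𝒯) :=
  (isOpen_traceSet O w e 𝒯).inter
    (isOpen_vertexTrace_mem w O {p | ∀ i j : Fin (n + 2), p i ∉ Shadow G (𝒯 j)})

/-- The elements of `awayTraceSet` for which the trace of `O` belongs to `P`. -/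
def awayTraceSetOf (O : V) (w : Fin (n + 1) → Letter Γ) (e : G.Dart) (𝒯 : Fin (n + 2) → G.Dart)
    (P : Set (Fin (n + 2) → V)) : Set (G ≃g G) :=
  {a ∈ awayTraceSet O w e 𝒯 | vertexTrace w a O ∈ P}

theorem isOpen_awayTraceSetOf (O : V) (w : Fin (n + 1) → Letter Γ) (e : G.Dart)
    (𝒯 : Fin (n + 2) → G.Dart) (P : Set (Fin (n + 2) → V)) :
    IsOpen (awayTraceSetOf O w e 𝒯 P) :=
  (isOpen_awayTraceSet O w e 𝒯).inter (isOpen_vertexTrace_mem w O P)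

theorem restrictShadow_apply (hG : G.Connected) {e : G.Dart} {f : G ≃g G} (h : dartMap f e = e)
    (v : Shadow G e) : ((restrictShadow hG e f).1 v : V) = f v := by
  unfold restrictShadow
  rw [dif_pos h]
  rfl

theorem continuous_restrictShadow (hG : G.Connected) (e : G.Dart) :
    Continuous (restrictShadow (G := G) hG e) := by
  refine continuous_of_isOpen_eval (subgroup_topology_eq (shadowAut e)) fun v y => ?_
  have : {f : G ≃g G | (restrictShadow hG e f).1 v = y} =
      ({f | dartMap f e = e} ∩ {f | f v = y}) ∪ ({f | dartMap f e = e}ᶜ ∩ {_f | v = y}) := by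
    ext f
    by_cases h : dartMap f e = e
    · simp [h, ← restrictShadow_apply hG h v, Subtype.ext_iff]
    · have h1 : restrictShadow hG e f = 1 := by rw [restrictShadow, dif_neg h]
      simp [h, h1]
  rw [this]
  exact ((isOpen_dartMap_eq e e).inter (isOpen_apply_eq _ _)).union
    ((isClosed_dartMap_eq e e).isOpen_compl.inter isOpen_const)

theorem continuous_restrictShadow_wordEval (hG : G.Connected) (e : G.Dart)
    (w : Fin (n + 1) → Letter Γ) :
    Continuous fun a : G ≃g G => restrictShadow hG e (wordEval w a) :=
  (continuous_restrictShadow hG e).comp (continuous_partialEval w (n + 1))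

end WordMaps

section Haar

variable {V : Type*} {G : SimpleGraph V}

theorem measure_apply_eq_le (μ : Measure (G ≃g G)) [μ.IsMulLeftInvariant] (O z : V) :
    μ {a | a O = z} ≤ μ {a | a O = O} := by
  by_cases h : ∃ b : G ≃g G, b O = z
  · obtain ⟨b, rfl⟩ := h
    rw [← measure_preimage_mul μ b]
    refine measure_mono fun a ha => ?_
    exact b.injective ha
  · have : {a : G ≃g G | a O = z} = ∅ := by
      ext a
      simp only [Set.mem_ofPred_eq, Set.mem_empty_iff_false, iff_false]
      exact fun ha => h ⟨a, ha⟩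
    rw [this]
    simp

variable [G.LocallyFinite]

theorem measure_apply_eq_lt_top (hG : G.Connected) {μ : Measure (G ≃g G)} [μ.IsMulLeftInvariant]
    {O : V} (hμ : μ {a | a O = O} < ⊤) (x y : V) : μ {a | a x = y} < ⊤ := by
  have hfin : {z | G.dist y z = G.dist x O}.Finite :=
    (finite_ball hG y (G.dist x O)).subset fun z hz => le_of_eq hz
  have hsub : {a : G ≃g G | a x = y} ⊆ ⋃ z ∈ {z | G.dist y z = G.dist x O}, {a | a O = z} := by
    intro a ha
    have ha : a x = y := ha
    simp only [Set.mem_iUnion]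
    refine ⟨a O, ?_, rfl⟩
    change G.dist y (a O) = _
    rw [← ha, dist_iso a hG]
  refine (measure_mono hsub).trans_lt ?_
  exact measure_biUnion_lt_top hfin fun z _ => (measure_apply_eq_le μ O z).trans_lt hμ

theorem measure_univ_eq_top (hT : G.IsTree) {d : ℕ} (hd : 3 ≤ d) (hreg : G.IsRegularOfDegree d)
    {μ : Measure (G ≃g G)} [μ.IsMulLeftInvariant] {O : V} (hμ : μ {a | a O = O} ≠ 0) :
    μ Set.univ = ⊤ := by
  have := infinite_vertices hT hd hreg O
  have := countable_vertices (G := G) hT.connected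
  have h1 : (Set.univ : Set (G ≃g G)) = ⋃ z, {a | a O = z} := by
    ext a
    simp
  rw [h1, measure_iUnion]
  · have h2 : ∀ z, μ {a : G ≃g G | a O = z} = μ {a | a O = O} := by
      intro z
      refine le_antisymm (measure_apply_eq_le μ O z) ?_
      obtain ⟨b, hb⟩ := exists_automorphism_apply_eq hT hreg O z
      rw [← measure_preimage_mul μ b {a | a O = z}]
      refine measure_mono fun a ha => ?_
      have ha : a O = O := ha
      change b (a O) = z
      rw [ha, hb]
    simp only [h2]
    exact ENNReal.tsum_const_eq_top_of_ne_zero hμ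
  · intro y z hyz
    refine Set.disjoint_left.2 fun a ha ha' => hyz ?_
    exact ha.symm.trans ha'
  · exact fun z => (isOpen_apply_eq O z).measurableSet

/-- Left invariant measures are invariant under right translation by elements of a vertex
stabilizer of finite measure. -/
theorem map_mul_right_eq (hG : G.Connected) {μ : Measure (G ≃g G)} [μ.IsMulLeftInvariant] {O : V}
    (hμ : μ {a | a O = O} < ⊤) {h : G ≃g G} (hO : h O = O) : μ.map (· * h) = μ := by
  have := countable_vertices hG
  have hmeas : Measurable fun a : G ≃g G => a * h := (continuous_mul_const h).measurable
  have hinv : h⁻¹ O = O := by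
    nth_rewrite 1 [← hO]
    exact RelIso.inv_apply_self h O
  have hcyl : ∀ (r : ℕ) (b : G ≃g G),
      μ {a | ∀ v ∈ {v | G.dist O v ≤ r}, a v = b v} = μ {a | ∀ v ∈ {v | G.dist O v ≤ r}, a v = v} := by
    intro r b
    rw [← measure_preimage_mul μ b]
    congr 1
    ext a
    refine forall₂_congr fun v _ => ?_
    exact b.injective.eq_iff
  refine (ext_of_cylinders (ev := fun f : G ≃g G => (f : V → V)) autTopologicalSpace_eq
    (B := fun r => {v | G.dist O v ≤ r}) (finite_ball hG O) ?_ (fun v => ⟨_, le_refl (G.dist O v)⟩)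
    ?_ ?_).symm
  · exact fun r s hrs v hv => le_trans hv hrs
  · intro r b
    rw [hcyl]
    refine ((measure_mono fun a ha => ?_).trans_lt hμ).ne
    exact ha O (by simp)
  · intro r b
    rw [hcyl, Measure.map_apply hmeas
      (isOpen_eval_eq_on autTopologicalSpace_eq (finite_ball hG O r) b).measurableSet,
      ← hcyl r (b * h⁻¹)]
    congr 1
    ext a
    constructor
    · intro ha v hv
      have h1 := ha (h v) (by
        change G.dist O (h v) ≤ r
        rw [← hO, dist_iso h hG]
        exact hv)
      change a (h v) = b v
      rw [h1]
      change b (h⁻¹ (h v)) = b v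
      rw [RelIso.inv_apply_self]
    · intro ha v hv
      have h1 : a (h (h⁻¹ v)) = b (h⁻¹ v) := ha (h⁻¹ v) (by
        change G.dist O (h⁻¹ v) ≤ r
        rw [← hinv, dist_iso h⁻¹ hG]
        exact hv)
      rw [RelIso.apply_inv_self] at h1
      exact h1

end Haar

section Transport

variable {V : Type*} {G : SimpleGraph V}

theorem dartMap_eq_iff {f : G ≃g G} {e e' : G.Dart} :
    dartMap f e = e' ↔ f e.fst = e'.fst ∧ f e.snd = e'.snd := by
  constructor
  · rintro rfl
    exact ⟨rfl, rfl⟩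
  · rintro ⟨h1, h2⟩
    exact SimpleGraph.Dart.ext _ _ (Prod.ext h1 h2)

theorem dist_snd_apply (hG : G.Connected) {f : G ≃g G} {e e' : G.Dart} (h : dartMap f e = e')
    (v : V) : G.dist e'.snd (f v) = G.dist e.snd v := by
  rw [← (dartMap_eq_iff.1 h).2, dist_iso f hG]

theorem apply_mem_shadow_iff (hG : G.Connected) {f : G ≃g G} {e e' : G.Dart}
    (h : dartMap f e = e') (v : V) : f v ∈ Shadow G e' ↔ v ∈ Shadow G e := by
  obtain ⟨h1, h2⟩ := dartMap_eq_iff.1 h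
  simp only [Shadow, Set.mem_ofPred_eq, ← h1, ← h2, dist_iso f hG]

/-- The vertices of `Shadow[e]` at distance at most `m` from its root. -/
def shadowBall (G : SimpleGraph V) (e : G.Dart) (m : ℕ) : Set V :=
  {v | v ∈ Shadow G e ∧ G.dist e.snd v ≤ m}

theorem finite_shadowBall [G.LocallyFinite] (hG : G.Connected) (e : G.Dart) (m : ℕ) :
    (shadowBall G e m).Finite :=
  (finite_ball hG e.snd m).subset fun _ hv => hv.2

theorem apply_mem_shadowBall_iff (hG : G.Connected) {f : G ≃g G} {e : G.Dart}
    (h : dartMap f e = e) {m : ℕ} (v : V) : f v ∈ shadowBall G e m ↔ v ∈ shadowBall G e m := by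
  unfold shadowBall
  rw [Set.mem_ofPred_eq, Set.mem_ofPred_eq, apply_mem_shadow_iff hG h, dist_snd_apply hG h]

/-- The automorphism is trivial outside `Shadow[e]` and up to level `m` of `Shadow[e]`. -/
def SupportedBelow (e : G.Dart) (m : ℕ) (θ : G ≃g G) : Prop :=
  ∀ v, v ∈ Shadow G e → m < G.dist e.snd v ∨ θ v = v

/-- The automorphism is trivial outside `Shadow[e]`. -/
def SupportedOn (e : G.Dart) (θ : G ≃g G) : Prop :=
  ∀ v, v ∉ Shadow G e → θ v = v

theorem inv_apply_eq_self {θ : G ≃g G} {v : V} (h : θ v = v) : θ⁻¹ v = v := by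
  nth_rewrite 1 [← h]
  exact RelIso.inv_apply_self θ v

end Transport

section Sites

variable {V : Type*} {G : SimpleGraph V} {Γ : Subgroup (G ≃g G)} {n : ℕ}

/-- Position `s` of a trace is the site of the letter `wᵢ`, i.e. `wᵢ = t` acts on the `s`-th
element of the trace, or `wᵢ = t⁻¹` produces it. -/
def IsSite (w : Fin (n + 1) → Letter Γ) (i : Fin (n + 1)) (s : Fin (n + 2)) : Prop :=
  (w i = .t ∧ s = i.castSucc) ∨ (w i = .tinv ∧ s = i.succ)

theorem exists_isSite (w : Fin (n + 1) → Letter Γ) {i : Fin (n + 1)} (hi : ¬ (w i).InGroup) :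
    ∃ s, IsSite w i s := by
  cases h : w i with
  | elt γ =>
    rw [h] at hi
    exact absurd trivial hi
  | t => exact ⟨_, Or.inl ⟨h, rfl⟩⟩
  | tinv => exact ⟨_, Or.inr ⟨h, rfl⟩⟩

theorem exists_isSite_or (w : Fin (n + 1) → Letter Γ) (hw : CyclicallyReduced w) :
    (∃ i s, IsSite w i s) ∨ (n = 0 ∧ ∃ γ : Γ, γ ≠ 1 ∧ w 0 = .elt γ) := by
  by_cases h : ∃ i, ¬ (w i).InGroup
  · obtain ⟨i, hi⟩ := h
    exact Or.inl ⟨i, exists_isSite w hi⟩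
  · push Not at h
    right
    refine ⟨?_, ?_⟩
    · by_contra hn
      exact (hw.2 (Nat.pos_of_ne_zero hn)).1 ⟨h _, h _⟩
    · cases h0 : w 0 with
      | elt γ => exact ⟨γ, hw.1.1 0 γ h0, rfl⟩
      | t =>
        have := h 0
        rw [h0] at this
        exact this.elim
      | tinv =>
        have := h 0
        rw [h0] at this
        exact this.elim

theorem IsSite.trace_ne {w : Fin (n + 1) → Letter Γ} (hw : CyclicallyReduced w) {α : Type*}
    {𝒯 : Fin (n + 2) → α}
    (h𝒯 : ∀ i j : Fin (n + 2), i < j → 𝒯 i = 𝒯 j → i = 0 ∧ j = Fin.last (n + 1))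
    {i j : Fin (n + 1)} {s s' : Fin (n + 2)} (hs : IsSite w i s) (hs' : IsSite w j s')
    (hij : i ≠ j) : 𝒯 s ≠ 𝒯 s' := by
  have hne : ∀ {i j s}, IsSite w i s → IsSite w j s → w i = .t → i = j := by
    intro i j s hs hs' hi
    rcases hs with ⟨-, h1⟩ | ⟨h0, -⟩
    · rcases hs' with ⟨-, h2⟩ | ⟨h2, h3⟩
      · rw [h1] at h2
        exact Fin.castSucc_injective _ h2
      · rw [h1] at h3
        have h4 : (i : ℕ) = j + 1 := by simpa [Fin.ext_iff] using h3
        have hj : (j : ℕ) < n := by omega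
        have h5 := hw.1.2 ⟨j, hj⟩
        have h6 : (⟨j, hj⟩ : Fin n).castSucc = j := rfl
        have h7 : (⟨j, hj⟩ : Fin n).succ = i := Fin.ext h4.symm
        rw [h6, h7] at h5
        exact absurd ⟨h2, hi⟩ h5.2.2
    · rw [hi] at h0
      cases h0
  have hends : ∀ {i j}, IsSite w i 0 → IsSite w j (Fin.last (n + 1)) → i ≠ j → False := by
    intro i j hs hs' hij
    rcases hs with ⟨h1, h2⟩ | ⟨h1, h2⟩
    · have hi : i = 0 := by
        rw [Fin.ext_iff] at h2 ⊢
        simpa using h2.symm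
      rcases hs' with ⟨h3, h4⟩ | ⟨h3, h4⟩
      · rw [Fin.ext_iff] at h4
        have := j.2
        simp at h4
        omega
      · have hj : j = Fin.last n := by
          rw [Fin.ext_iff] at h4 ⊢
          simp at h4 ⊢
          omega
        have hn : 0 < n := by
          rcases Nat.eq_zero_or_pos n with hn | hn
          · subst hn
            exact absurd (Fin.ext (by omega)) hij
          · exact hn
        rw [hi] at h1
        rw [hj] at h3
        exact (hw.2 hn).2.2 ⟨h3, h1⟩
    · rw [Fin.ext_iff] at h2
      simp at h2
  intro hss
  rcases lt_trichotomy s s' with h | h | h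
  · obtain ⟨rfl, rfl⟩ := h𝒯 _ _ h hss
    exact hends hs hs' hij
  · subst h
    rcases id hs with ⟨h1, h2⟩ | ⟨h1, h2⟩
    · exact hij (hne hs hs' h1)
    · rcases id hs' with ⟨h3, h4⟩ | ⟨h3, h4⟩
      · exact hij (hne hs' hs h3).symm
      · rw [h2] at h4
        exact hij (Fin.succ_injective _ h4)
  · obtain ⟨rfl, rfl⟩ := h𝒯 _ _ h hss.symm
    exact hends hs' hs hij.symm

theorem partialEval_succ (w : Fin (n + 1) → Letter Γ) (a : G ≃g G) (j : Fin (n + 1)) :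
    partialEval w a (j + 1) = (w j).eval a * partialEval w a j := by
  rw [partialEval, dif_pos j.2]

/-- The effect on a trace of a right translation that interferes with a single letter only. -/
theorem partialEval_mul_right (w : Fin (n + 1) → Letter Γ) (a h : G ≃g G) (θ : V → V)
    {i : Fin (n + 1)} {s : Fin (n + 2)} (hs : IsSite w i s) {v : V}
    (hfix : ∀ (j : Fin (n + 1)) (s' : Fin (n + 2)), j ≠ i → IsSite w j s' →
      h (partialEval w a s' v) = partialEval w a s' v ∧
      h (partialEval w a s' (θ v)) = partialEval w a s' (θ v))
    (ht : w i = .t → h (partialEval w a s v) = partialEval w a s (θ v))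
    (htinv : w i = .tinv → h (partialEval w a s (θ v)) = partialEval w a s v)
    (k : ℕ) (hk : k ≤ n + 1) :
    partialEval w (a * h) k v = partialEval w a k (if k ≤ i then v else θ v) := by
  induction k with
  | zero => simp [partialEval]
  | succ k ih =>
    have ih := ih (by omega)
    obtain ⟨j, rfl⟩ : ∃ j : Fin (n + 1), (j : ℕ) = k := ⟨⟨k, by omega⟩, rfl⟩
    rw [partialEval_succ, partialEval_succ, RelIso.mul_apply, RelIso.mul_apply, ih]
    by_cases hji : j = i
    · subst hji
      rw [if_pos le_rfl, if_neg (by omega)]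
      rcases hs with ⟨h1, rfl⟩ | ⟨h1, rfl⟩
      · have h2 : h (partialEval w a j v) = partialEval w a j (θ v) := ht h1
        rw [h1]
        change a (h _) = a _
        rw [h2]
      · have h2 : h (partialEval w a (j + 1) (θ v)) = partialEval w a (j + 1) v := htinv h1
        rw [partialEval_succ, h1] at h2
        rw [h1]
        change (a * h)⁻¹ _ = a⁻¹ _
        rw [mul_inv_rev, RelIso.mul_apply]
        change h (a⁻¹ (partialEval w a j (θ v))) = a⁻¹ (partialEval w a j v) at h2
        rw [← h2, RelIso.inv_apply_self]
    · have hcond : (if (j : ℕ) + 1 ≤ i then v else θ v) = if (j : ℕ) ≤ i then v else θ v := by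
        have : (j : ℕ) ≠ i := fun hh => hji (Fin.ext hh)
        split_ifs <;> first | rfl | omega
      rw [hcond]
      set u := if (j : ℕ) ≤ i then v else θ v with hu
      have hu' : u = v ∨ u = θ v := by
        rw [hu]
        split_ifs
        · exact Or.inl rfl
        · exact Or.inr rfl
      have hfix' : ∀ s', IsSite w j s' → h (partialEval w a s' u) = partialEval w a s' u := by
        intro s' hs'
        rcases hu' with h1 | h1 <;> rw [h1]
        · exact (hfix j s' hji hs').1
        · exact (hfix j s' hji hs').2
      cases hj : w j with
      | elt γ => rfl
      | t =>
        change a (h _) = a _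
        have := hfix' j.castSucc (Or.inl ⟨hj, rfl⟩)
        rw [Fin.val_castSucc] at this
        rw [this]
      | tinv =>
        change (a * h)⁻¹ _ = a⁻¹ _
        have := hfix' j.succ (Or.inr ⟨hj, rfl⟩)
        rw [Fin.val_succ, partialEval_succ, hj] at this
        change h (a⁻¹ (partialEval w a j u)) = a⁻¹ (partialEval w a j u) at this
        rw [mul_inv_rev, RelIso.mul_apply]
        nth_rewrite 1 [← this]
        rw [RelIso.inv_apply_self]

end Sites

section Modification

variable {V : Type*} {G : SimpleGraph V} {Γ : Subgroup (G ≃g G)} {n : ℕ}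

/-- The standing assumptions on the word `w`, the edge `e` and its prospective trace `𝒯`. -/
structure TraceData (O : V) (w : Fin (n + 1) → Letter Γ) (e : G.Dart)
    (𝒯 : Fin (n + 2) → G.Dart) : Prop where
  reduced : CyclicallyReduced w
  pos : ∀ i, PosDart G O (𝒯 i)
  zero : 𝒯 0 = e
  last : 𝒯 (Fin.last (n + 1)) = e
  simple : ∀ i j : Fin (n + 2), i < j → 𝒯 i = 𝒯 j → i = 0 ∧ j = Fin.last (n + 1)

theorem TraceData.pos_edge {O : V} {w : Fin (n + 1) → Letter Γ} {e : G.Dart}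
    {𝒯 : Fin (n + 2) → G.Dart} (D : TraceData O w e 𝒯) : PosDart G O e :=
  D.zero ▸ D.pos 0

theorem dartMap_partialEval {O : V} {w : Fin (n + 1) → Letter Γ} {e : G.Dart}
    {𝒯 : Fin (n + 2) → G.Dart} {a : G ≃g G} (ha : a ∈ traceSet O w e 𝒯) (i : Fin (n + 2)) :
    dartMap (partialEval w a i) e = 𝒯 i :=
  congrFun ha.2 i

theorem TraceData.dartMap_wordEval {O : V} {w : Fin (n + 1) → Letter Γ} {e : G.Dart}
    {𝒯 : Fin (n + 2) → G.Dart} (D : TraceData O w e 𝒯) {a : G ≃g G} (ha : a ∈ traceSet O w e 𝒯) :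
    dartMap (wordEval w a) e = e := by
  have := dartMap_partialEval ha (Fin.last (n + 1))
  rwa [D.last] at this

/-- A site whose edge has maximal distance from `O`. -/
def IsDeepestSite (O : V) (w : Fin (n + 1) → Letter Γ) (𝒯 : Fin (n + 2) → G.Dart)
    (i : Fin (n + 1)) (s : Fin (n + 2)) : Prop :=
  IsSite w i s ∧ ∀ j s', IsSite w j s' → G.dist O (𝒯 s').snd ≤ G.dist O (𝒯 s).snd

theorem exists_isDeepestSite (O : V) (w : Fin (n + 1) → Letter Γ) (𝒯 : Fin (n + 2) → G.Dart)
    (h : ∃ i s, IsSite w i s) : ∃ i s, IsDeepestSite O w 𝒯 i s := by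
  obtain ⟨i, s, h⟩ := h
  have hfin : {p : Fin (n + 1) × Fin (n + 2) | IsSite w p.1 p.2}.Finite := Set.toFinite _
  obtain ⟨p, hp, hmax⟩ := Set.exists_max_image _ (fun p => G.dist O (𝒯 p.2).snd) hfin ⟨(i, s), h⟩
  exact ⟨p.1, p.2, hp, fun j s' h' => hmax (j, s') h'⟩

theorem mul_right_mem_awayTraceSetOf (hT : G.IsTree) {O : V} {w : Fin (n + 1) → Letter Γ}
    {e : G.Dart} {𝒯 : Fin (n + 2) → G.Dart} (D : TraceData O w e 𝒯)
    {P : Set (Fin (n + 2) → V)} {i : Fin (n + 1)} {s : Fin (n + 2)}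
    (hs : IsDeepestSite O w 𝒯 i s) {m : ℕ} {θ h a : G ≃g G}
    (ha : a ∈ awayTraceSetOf O w e 𝒯 P)
    (hθ : SupportedOn e θ) (hθm : SupportedBelow e m θ)
    (hh : SupportedOn (𝒯 s) h) (hhm : SupportedBelow (𝒯 s) m h)
    (ht : ∀ v ∈ shadowBall G e (m + 1), w i = .t →
      h (partialEval w a s v) = partialEval w a s (θ v))
    (htinv : ∀ v ∈ shadowBall G e (m + 1), w i = .tinv →
      h (partialEval w a s (θ v)) = partialEval w a s v) :
    a * h ∈ awayTraceSetOf O w e 𝒯 P ∧ ∀ v ∈ shadowBall G e (m + 1), ∀ k ≤ n + 1,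
      partialEval w (a * h) k v = partialEval w a k (if k ≤ i then v else θ v) := by
  have hG := hT.connected
  have hpose := D.pos_edge
  have htr := ha.1.1
  have haway := ha.1.2
  have hθO : θ O = O := hθ O (root_notMem_shadow hT hpose)
  have hθfst : θ e.fst = e.fst := hθ _ (fst_notMem_shadow e)
  have hθsnd : θ e.snd = e.snd := by
    rcases hθm e.snd (snd_mem_shadow e) with h1 | h1
    · simp at h1
    · exact h1
  have hθe : dartMap θ e = e := dartMap_eq_iff.2 ⟨hθfst, hθsnd⟩
  have hlow : ∀ u, G.dist O u ≤ G.dist O (𝒯 s).snd + m → h u = u := by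
    intro u hu
    by_cases hus : u ∈ Shadow G (𝒯 s)
    · have h1 := dist_of_mem_shadow hT (D.pos s) hus
      rcases hhm u hus with h2 | h2
      · omega
      · exact h2
    · exact hh u hus
  have hO : ∀ k ≤ n + 1, partialEval w (a * h) k O = partialEval w a k O := by
    intro k hk
    have hfixO : ∀ s', h (partialEval w a (s' : Fin (n + 2)) O) = partialEval w a s' O :=
      fun s' => hh _ (haway s' s)
    have := partialEval_mul_right w a h θ hs.1 (v := O)
      (fun j s' _ _ => ⟨hfixO s', by rw [hθO]; exact hfixO s'⟩)
      (fun _ => by rw [hθO]; exact hfixO s) (fun _ => by rw [hθO]; exact hfixO s) k hk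
    rw [this, hθO, ite_self]
  have hfst : ∀ k ≤ n + 1, partialEval w (a * h) k e.fst = partialEval w a k e.fst := by
    intro k hk
    have himg : ∀ s' : Fin (n + 2), partialEval w a s' e.fst = (𝒯 s').fst := fun s' =>
      (dartMap_eq_iff.1 (dartMap_partialEval htr s')).1
    have hfix : ∀ (j : Fin (n + 1)) (s' : Fin (n + 2)), IsSite w j s' →
        h (partialEval w a s' e.fst) = partialEval w a s' e.fst := by
      intro j s' hs'
      apply hlow
      rw [himg]
      have h1 := hs.2 j s' hs'
      have h2 := (D.pos s').dist_snd hT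
      omega
    have := partialEval_mul_right w a h θ hs.1 (v := e.fst)
      (fun j s' _ hs' => ⟨hfix j s' hs', by rw [hθfst]; exact hfix j s' hs'⟩)
      (fun _ => by rw [hθfst]; exact hfix i s hs.1)
      (fun _ => by rw [hθfst]; exact hfix i s hs.1) k hk
    rw [this, hθfst, ite_self]
  have hball : ∀ v ∈ shadowBall G e (m + 1), ∀ k ≤ n + 1,
      partialEval w (a * h) k v = partialEval w a k (if k ≤ i then v else θ v) := by
    have hfix : ∀ v ∈ shadowBall G e (m + 1), ∀ (j : Fin (n + 1)) (s' : Fin (n + 2)), j ≠ i →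
        IsSite w j s' → h (partialEval w a s' v) = partialEval w a s' v := by
      intro v hv j s' hj hs'
      have hmap := dartMap_partialEval htr s'
      have h1 : partialEval w a s' v ∈ Shadow G (𝒯 s') := (apply_mem_shadow_iff hG hmap v).2 hv.1
      have h2 := dist_of_mem_shadow hT (D.pos s') h1
      rw [dist_snd_apply hG hmap] at h2
      have h3 := hs.2 j s' hs'
      have h4 := hv.2
      by_cases hlt : G.dist O (partialEval w a s' v) ≤ G.dist O (𝒯 s).snd + m
      · exact hlow _ hlt
      · apply hh
        intro h5
        have h6 : 𝒯 s' = 𝒯 s := (D.pos s').eq_of_mem_shadow hT (D.pos s) (by omega) h1 h5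
        exact hs'.trace_ne D.reduced D.simple hs.1 hj h6
    intro v hv k hk
    exact partialEval_mul_right w a h θ hs.1 (fun j s' hj hs' => ⟨hfix v hv j s' hj hs',
      hfix (θ v) ((apply_mem_shadowBall_iff hG hθe v).2 hv) j s' hj hs'⟩) (ht v hv) (htinv v hv) k hk
  refine ⟨?_, hball⟩
  have hvt : vertexTrace w (a * h) O = vertexTrace w a O := by
    funext k
    exact hO k (by omega)
  have het : edgeTrace w (a * h) e = 𝒯 := by
    rw [← htr.2]
    funext k
    refine SimpleGraph.Dart.ext _ _ (Prod.ext ?_ ?_)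
    · exact hfst k (by omega)
    · have := hball e.snd ⟨snd_mem_shadow e, by simp⟩ k (by omega)
      rw [hθsnd, ite_self] at this
      exact this
  refine ⟨⟨⟨?_, het⟩, ?_⟩, ?_⟩
  · exact (hO (n + 1) le_rfl).trans htr.1
  · rw [hvt]
    exact haway
  · rw [hvt]
    exact ha.2

/-- The part of `awayTraceSetOf` on which `w(a)` agrees with `κ` on `F`. -/
def evalCylinder (O : V) (w : Fin (n + 1) → Letter Γ) (e : G.Dart) (𝒯 : Fin (n + 2) → G.Dart)
    (P : Set (Fin (n + 2) → V)) (F : Set V) (κ : V → V) : Set (G ≃g G) :=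
  {a ∈ awayTraceSetOf O w e 𝒯 P | ∀ v ∈ F, wordEval w a v = κ v}

theorem isOpen_eval_agree {F : Set V} (hF : F.Finite) (w : Fin (n + 1) → Letter Γ) (k : ℕ)
    (κ : V → V) : IsOpen {a : G ≃g G | ∀ v ∈ F, partialEval w a k v = κ v} :=
  (isOpen_eval_eq_on autTopologicalSpace_eq hF κ).preimage (continuous_partialEval w k)

theorem isOpen_evalCylinder (O : V) (w : Fin (n + 1) → Letter Γ) (e : G.Dart)
    (𝒯 : Fin (n + 2) → G.Dart) (P : Set (Fin (n + 2) → V)) {F : Set V} (hF : F.Finite)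
    (κ : V → V) : IsOpen (evalCylinder O w e 𝒯 P F κ) :=
  (isOpen_awayTraceSetOf O w e 𝒯 P).inter (isOpen_eval_agree hF w (n + 1) κ)

theorem measure_evalCylinder_le [G.LocallyFinite] (hT : G.IsTree) {O : V} {μ : Measure (G ≃g G)}
    [μ.IsMulLeftInvariant] (hμ : μ {a | a O = O} < ⊤) {w : Fin (n + 1) → Letter Γ}
    {e : G.Dart} {𝒯 : Fin (n + 2) → G.Dart} (D : TraceData O w e 𝒯) (hsite : ∃ i s, IsSite w i s)
    (P : Set (Fin (n + 2) → V)) {m : ℕ} {θ : G ≃g G} (hθ : SupportedOn e θ)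
    (hθm : SupportedBelow e m θ) (κ : V → V) :
    μ (evalCylinder O w e 𝒯 P (shadowBall G e (m + 1)) κ) ≤
      μ (evalCylinder O w e 𝒯 P (shadowBall G e (m + 1)) (κ ∘ θ)) := by
  classical
  have hG := hT.connected
  have := countable_vertices hG
  obtain ⟨i, s, hs⟩ := exists_isDeepestSite O w 𝒯 hsite
  set F := shadowBall G e (m + 1) with hF
  have hFfin : F.Finite := finite_shadowBall hG e (m + 1)
  have := hFfin.to_subtype
  have hθsnd : θ e.snd = e.snd := by
    rcases hθm e.snd (snd_mem_shadow e) with h1 | h1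
    · simp at h1
    · exact h1
  have hθe : dartMap θ e = e := dartMap_eq_iff.2 ⟨hθ _ (fst_notMem_shadow e), hθsnd⟩
  let θF : F ≃ F := θ.toEquiv.subtypeEquiv fun v => (apply_mem_shadowBall_iff hG hθe v).symm
  let τ : F ≃ F := if w i = .t then Equiv.refl F else θF
  let R : (F → V) → Set (G ≃g G) := fun π => {a | ∀ v : F, partialEval w a s v = π v}
  have hRopen : ∀ π, IsOpen (R π) := by
    intro π
    have := isOpen_eval_agree hFfin w s (fun v => if hv : v ∈ F then π ⟨v, hv⟩ else v)
    convert this using 1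
    ext a
    constructor
    · intro ha v hv
      rw [dif_pos hv]
      exact ha ⟨v, hv⟩
    · intro ha v
      have := ha v v.2
      rwa [dif_pos v.2] at this
  have hRdisj : Pairwise (Function.onFun Disjoint R) := by
    intro π π' hne
    refine Set.disjoint_left.2 fun a ha ha' => hne ?_
    funext v
    rw [← ha v, ← ha' v]
  have hRcover : ∀ S : Set (G ≃g G), S = ⋃ π, S ∩ R π := by
    intro S
    rw [← Set.inter_iUnion, Set.inter_eq_left.2]
    intro a _
    exact Set.mem_iUnion.2 ⟨fun v => partialEval w a s v, fun v => rfl⟩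
  have hstep : ∀ π, μ (evalCylinder O w e 𝒯 P F κ ∩ R π) ≤
      μ (evalCylinder O w e 𝒯 P F (κ ∘ θ) ∩ R (π ∘ τ)) := by
    intro π
    rcases Set.eq_empty_or_nonempty (evalCylinder O w e 𝒯 P F κ ∩ R π) with hemp | ⟨a₀, ha₀, hπ₀⟩
    · rw [hemp]
      simp
    set p := partialEval w a₀ s with hp
    have hpe : dartMap p e = 𝒯 s := dartMap_partialEval ha₀.1.1.1 s
    set ϑ : G ≃g G := if w i = .t then θ else θ⁻¹ with hϑ
    have hϑfix : ∀ v, θ v = v → ϑ v = v := by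
      intro v hv
      rw [hϑ]
      split_ifs
      · exact hv
      · exact inv_apply_eq_self hv
    set h : G ≃g G := p * ϑ * p⁻¹ with hh
    have happ : ∀ v, h (p v) = p (ϑ v) := by
      intro v
      rw [hh, RelIso.mul_apply, RelIso.mul_apply, RelIso.inv_apply_self]
    have hfix : ∀ v, θ v = v → h (p v) = p v := by
      intro v hv
      rw [happ, hϑfix v hv]
    have hh1 : SupportedOn (𝒯 s) h := by
      intro u hu
      obtain ⟨v, rfl⟩ := p.surjective u
      rw [apply_mem_shadow_iff hG hpe] at hu
      exact hfix v (hθ v hu)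
    have hh2 : SupportedBelow (𝒯 s) m h := by
      intro u hu
      obtain ⟨v, rfl⟩ := p.surjective u
      rw [apply_mem_shadow_iff hG hpe] at hu
      rw [dist_snd_apply hG hpe]
      exact (hθm v hu).imp_right (hfix v)
    have hhO : h O = O := hh1 O (root_notMem_shadow hT (D.pos s))
    have hright : ∀ S : Set (G ≃g G), MeasurableSet S → μ ((· * h) ⁻¹' S) = μ S := by
      intro S hS
      rw [← Measure.map_apply (continuous_mul_const h).measurable hS, map_mul_right_eq hG hμ hhO]
    rw [← hright _ (((isOpen_evalCylinder O w e 𝒯 P hFfin (κ ∘ θ)).inter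
      (hRopen (π ∘ τ))).measurableSet)]
    refine measure_mono ?_
    rintro a ⟨ha, hπ⟩
    have hpa : ∀ v ∈ F, partialEval w a s v = p v := by
      intro v hv
      exact (hπ ⟨v, hv⟩).trans (hπ₀ ⟨v, hv⟩).symm
    have hθF : ∀ v ∈ F, θ v ∈ F := fun v hv => (apply_mem_shadowBall_iff hG hθe v).2 hv
    obtain ⟨hmem, heval⟩ := mul_right_mem_awayTraceSetOf hT D hs ha.1 hθ hθm hh1 hh2
      (by
        intro v hv hwi
        rw [hpa v hv, hpa _ (hθF v hv), happ, hϑ, if_pos hwi])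
      (by
        intro v hv hwi
        rw [hpa v hv, hpa _ (hθF v hv), happ, hϑ, if_neg (by rw [hwi]; exact fun h => by cases h),
          RelIso.inv_apply_self])
    refine ⟨⟨hmem, ?_⟩, ?_⟩
    · intro v hv
      have h1 := heval v hv (n + 1) le_rfl
      rw [if_neg (by omega)] at h1
      exact h1.trans (ha.2 (θ v) (hθF v hv))
    · intro v
      have h1 := heval v v.2 s (by omega)
      change partialEval w (a * h) s v = π (τ v)
      rw [h1, ← hπ (τ v)]
      rcases id hs.1 with ⟨h2, h3⟩ | ⟨h2, h3⟩
      · have h4 : τ = Equiv.refl F := if_pos h2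
        rw [h4, if_pos (by rw [h3]; rfl)]
        rfl
      · have h4 : τ = θF := if_neg (by rw [h2]; exact fun h => by cases h)
        rw [h4, if_neg (by rw [h3]; simp)]
        rfl
  calc μ (evalCylinder O w e 𝒯 P F κ)
      = μ (⋃ π, evalCylinder O w e 𝒯 P F κ ∩ R π) := by rw [← hRcover]
    _ ≤ ∑' π, μ (evalCylinder O w e 𝒯 P F κ ∩ R π) := measure_iUnion_le _
    _ ≤ ∑' π : F → V, μ (evalCylinder O w e 𝒯 P F (κ ∘ θ) ∩ R (π ∘ τ)) := ENNReal.tsum_le_tsum hstep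
    _ = ∑' π : F → V, μ (evalCylinder O w e 𝒯 P F (κ ∘ θ) ∩ R π) :=
        (τ.symm.arrowCongr (Equiv.refl V)).tsum_eq
          fun π => μ (evalCylinder O w e 𝒯 P F (κ ∘ θ) ∩ R π)
    _ = μ (⋃ π, evalCylinder O w e 𝒯 P F (κ ∘ θ) ∩ R π) := by
        rw [measure_iUnion]
        · intro π π' hne
          exact (hRdisj hne).mono Set.inter_subset_right Set.inter_subset_right
        · exact fun π => ((isOpen_evalCylinder O w e 𝒯 P hFfin _).inter (hRopen π)).measurableSet
    _ = μ (evalCylinder O w e 𝒯 P F (κ ∘ θ)) := by rw [← hRcover]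

end Modification

section Extension

variable {V : Type*} {G : SimpleGraph V}

/-- Automorphisms of `Shadow[e]` extend to the whole tree by the identity. -/
theorem exists_extension (hT : G.IsTree) {O : V} {e : G.Dart} (he : PosDart G O e)
    (g : shadowAut e) : ∃ θ : G ≃g G, SupportedOn e θ ∧ ∀ v : Shadow G e, θ v = g.1 v := by
  classical
  let p : Equiv.Perm V := Equiv.Perm.ofSubtype g.1.toEquiv
  have hin : ∀ v : Shadow G e, p v = g.1 v := fun v => Equiv.Perm.ofSubtype_apply_of_mem _ v.2
  have hout : ∀ v, v ∉ Shadow G e → p v = v := fun v hv =>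
    Equiv.Perm.ofSubtype_apply_of_not_mem _ hv
  have hmixed : ∀ (u : Shadow G e) (v : V), v ∉ Shadow G e → (G.Adj (g.1 u) v ↔ G.Adj u v) := by
    intro u v hv
    have hg : g.1 (shadowRoot e) = shadowRoot e := g.2
    have hroot : ∀ u : Shadow G e, (u : V) = e.snd ↔ u = shadowRoot e := fun u =>
      (Subtype.ext_iff (a2 := shadowRoot e)).symm
    have hiff : ((g.1 u : Shadow G e) : V) = e.snd ↔ (u : V) = e.snd := by
      rw [hroot, hroot]
      nth_rewrite 1 [← hg]
      exact g.1.injective.eq_iff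
    constructor
    · intro h
      obtain ⟨h1, h2⟩ := eq_of_adj_shadow hT he (g.1 u).2 hv h
      rw [hiff.1 h1, ← h1]
      exact h
    · intro h
      obtain ⟨h1, h2⟩ := eq_of_adj_shadow hT he u.2 hv h
      rw [hiff.2 h1, ← h1]
      exact h
  refine ⟨⟨p, ?_⟩, hout, hin⟩
  intro u v
  by_cases hu : u ∈ Shadow G e <;> by_cases hv : v ∈ Shadow G e
  · rw [hin ⟨u, hu⟩, hin ⟨v, hv⟩]
    exact g.1.map_rel_iff (a := ⟨u, hu⟩) (b := ⟨v, hv⟩)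
  · rw [hin ⟨u, hu⟩, hout v hv]
    exact hmixed ⟨u, hu⟩ v hv
  · rw [hin ⟨v, hv⟩, hout u hu, G.adj_comm, G.adj_comm u]
    exact hmixed ⟨v, hv⟩ u hu
  · rw [hout u hu, hout v hv]

end Extension

section ShadowMeasures

variable {V : Type*} {G : SimpleGraph V} {e : G.Dart}

/-- The elements of `Aut(Shadow[e])` that agree with `κ` up to level `r`. -/
def shadowCylinder (r : ℕ) (κ : shadowAut e) : Set (shadowAut e) :=
  {f | ∀ v ∈ {v : Shadow G e | G.dist e.snd v ≤ r}, f.1 v = κ.1 v}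

theorem finite_shadow_level_le [G.LocallyFinite] (hG : G.Connected) (e : G.Dart) (r : ℕ) :
    {v : Shadow G e | G.dist e.snd v ≤ r}.Finite :=
  (finite_ball hG e.snd r).preimage Subtype.val_injective.injOn

theorem isOpen_shadowCylinder [G.LocallyFinite] (hG : G.Connected) (r : ℕ) (κ : shadowAut e) :
    IsOpen (shadowCylinder r κ) :=
  isOpen_eval_eq_on (subgroup_topology_eq (shadowAut e)) (finite_shadow_level_le hG e r) κ.1

theorem mem_shadowCylinder_self (r : ℕ) (κ : shadowAut e) : κ ∈ shadowCylinder r κ :=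
  fun _ _ => rfl

theorem shadowCylinder_eq_of_mem {r : ℕ} {κ f : shadowAut e} (h : f ∈ shadowCylinder r κ) :
    shadowCylinder r f = shadowCylinder r κ := by
  ext x
  refine forall₂_congr fun v hv => ?_
  rw [h v hv]

theorem shadowCylinder_zero (hG : G.Connected) (κ : shadowAut e) :
    shadowCylinder 0 κ = Set.univ := by
  refine Set.eq_univ_of_forall fun f v hv => ?_
  have h1 : G.dist e.snd v ≤ 0 := hv
  have h2 : v = shadowRoot e := Subtype.ext (hG.dist_eq_zero_iff.1 (Nat.le_zero.1 h1)).symm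
  rw [h2, show f.1 (shadowRoot e) = shadowRoot e from f.2,
    show κ.1 (shadowRoot e) = shadowRoot e from κ.2]

theorem preimage_mul_left_shadowCylinder (g : shadowAut e) (r : ℕ) (κ : shadowAut e) :
    (fun f => g * f) ⁻¹' shadowCylinder r κ = shadowCylinder r (g⁻¹ * κ) := by
  ext f
  refine forall₂_congr fun v _ => ?_
  change g.1 (f.1 v) = κ.1 v ↔ f.1 v = g.1⁻¹ (κ.1 v)
  constructor
  · intro h
    rw [← h, RelIso.inv_apply_self]
  · intro h
    rw [h, RelIso.apply_inv_self]

theorem eq_of_mul_left_eq_of_ne_top {c x y : ENNReal} (hc : c ≠ 0) (h : c * x = c * y)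
    (hx : c * x ≠ ⊤) : x = y := by
  by_cases hct : c = ⊤
  · have key : ∀ z : ENNReal, c * z ≠ ⊤ → z = 0 := by
      intro z hz
      by_contra hz0
      exact hz (by rw [hct, ENNReal.top_mul hz0])
    rw [key x hx, key y (h ▸ hx)]
  · exact (ENNReal.mul_right_inj hc hct).1 h

/-- If refining a cylinder gives cylinders of equal measure, then the measure of a cylinder
depends only on its depth. -/
theorem measure_shadowCylinder_eq [G.LocallyFinite] (hG : G.Connected)
    {ν : Measure (shadowAut e)} [IsFiniteMeasure ν]
    (hν : ∀ m (κ κ' : shadowAut e), κ' ∈ shadowCylinder m κ →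
      ν (shadowCylinder (m + 1) κ) = ν (shadowCylinder (m + 1) κ'))
    (r : ℕ) (κ κ' : shadowAut e) : ν (shadowCylinder r κ) = ν (shadowCylinder r κ') := by
  have := countable_vertices hG
  induction r generalizing κ κ' with
  | zero => rw [shadowCylinder_zero hG, shadowCylinder_zero hG]
  | succ m ih =>
    let 𝒞 : Set (Set (shadowAut e)) := shadowCylinder (m + 1) '' shadowCylinder m 1
    have hcount : 𝒞.Countable :=
      (countable_range_cylinder (fun f : shadowAut e => (f.1 : Shadow G e → Shadow G e))
        (finite_shadow_level_le hG e (m + 1))).mono (Set.image_subset_range _ _)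
    have := hcount.to_subtype
    have hsplit : ∀ κ : shadowAut e, shadowCylinder m κ = ⋃ s : 𝒞, (fun f => κ⁻¹ * f) ⁻¹' s.1 := by
      intro κ
      have h1 : shadowCylinder m κ = (fun f => κ⁻¹ * f) ⁻¹' shadowCylinder m 1 := by
        rw [preimage_mul_left_shadowCylinder, inv_inv, mul_one]
      rw [h1, ← Set.preimage_iUnion]
      congr 1
      ext f
      simp only [Set.mem_iUnion, Subtype.exists]
      constructor
      · intro hf
        exact ⟨_, ⟨f, hf, rfl⟩, mem_shadowCylinder_self _ f⟩
      · rintro ⟨_, ⟨g, hg, rfl⟩, hf⟩ v hv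
        rw [hf v (le_trans hv (Nat.le_succ m)), hg v hv]
    have hsum : ∀ κ : shadowAut e, ν (shadowCylinder m κ) =
        (ENat.card 𝒞 : ENNReal) * ν (shadowCylinder (m + 1) κ) := by
      intro κ
      rw [← ENNReal.tsum_const, hsplit κ, measure_iUnion]
      · refine tsum_congr fun s => ?_
        obtain ⟨_, g, hg, rfl⟩ := s
        dsimp only
        rw [preimage_mul_left_shadowCylinder, inv_inv]
        refine (hν m κ _ fun v hv => ?_).symm
        change κ.1 (g.1 v) = κ.1 v
        rw [hg v hv]
        rfl
      · rintro ⟨_, g, hg, rfl⟩ ⟨_, g', hg', rfl⟩ hne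
        refine Disjoint.preimage _ (Set.disjoint_left.2 fun f hf hf' => hne ?_)
        apply Subtype.ext
        exact (shadowCylinder_eq_of_mem hf).symm.trans (shadowCylinder_eq_of_mem hf')
      · rintro ⟨_, g, hg, rfl⟩
        exact ((isOpen_shadowCylinder hG (m + 1) g).preimage
          (continuous_const_mul κ⁻¹)).measurableSet
    refine eq_of_mul_left_eq_of_ne_top (c := (ENat.card 𝒞 : ENNReal)) ?_ ?_ ?_
    · have : Nonempty 𝒞 := ⟨⟨_, 1, mem_shadowCylinder_self m 1, rfl⟩⟩
      rw [ne_eq, ENat.toENNReal_eq_zero, ENat.card_eq_zero_iff_empty, not_isEmpty_iff]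
      exact this
    · rw [← hsum, ← hsum, ih κ κ']
    · rw [← hsum]
      exact measure_ne_top ν _

theorem isMulLeftInvariant_of_shadowCylinder [G.LocallyFinite] (hG : G.Connected)
    {ν : Measure (shadowAut e)} [IsFiniteMeasure ν]
    (hν : ∀ r (κ κ' : shadowAut e), ν (shadowCylinder r κ) = ν (shadowCylinder r κ')) :
    ν.IsMulLeftInvariant := by
  have := countable_vertices hG
  refine ⟨fun g => ?_⟩
  refine (ext_of_cylinders (ev := fun f : shadowAut e => (f.1 : Shadow G e → Shadow G e))
    (subgroup_topology_eq (shadowAut e)) (B := fun r => {v : Shadow G e | G.dist e.snd v ≤ r})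
    (finite_shadow_level_le hG e) (fun r s hrs v hv => le_trans hv hrs)
    (fun v => ⟨_, le_refl (G.dist e.snd v)⟩) (fun r κ => measure_ne_top ν _) ?_).symm
  intro r κ
  change ν (shadowCylinder r κ) = (ν.map (g * ·)) (shadowCylinder r κ)
  rw [Measure.map_apply (continuous_const_mul g).measurable
    (isOpen_shadowCylinder hG r κ).measurableSet]
  change _ = ν ((fun f => g * f) ⁻¹' shadowCylinder r κ)
  rw [preimage_mul_left_shadowCylinder]
  exact hν r _ _

theorem isHaarMeasure_of_shadowCylinder [G.LocallyFinite] (hG : G.Connected)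
    {ν : Measure (shadowAut e)} [IsFiniteMeasure ν] (hν0 : ν ≠ 0)
    (hν : ∀ r (κ κ' : shadowAut e), ν (shadowCylinder r κ) = ν (shadowCylinder r κ')) :
    ν.IsHaarMeasure := by
  have := countable_vertices hG
  have := isMulLeftInvariant_of_shadowCylinder hG hν
  have : ν.IsOpenPosMeasure := isOpenPosMeasure_of_cylinders
    (ev := fun f : shadowAut e => (f.1 : Shadow G e → Shadow G e))
    (subgroup_topology_eq (shadowAut e)) (B := fun r => {v : Shadow G e | G.dist e.snd v ≤ r})
    (finite_shadow_level_le hG e) (fun r s hrs v hv => le_trans hv hrs)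
    (fun v => ⟨_, le_refl (G.dist e.snd v)⟩) hν0 hν
  exact {}

end ShadowMeasures

section RestrictedLaw

variable {V : Type*} {G : SimpleGraph V} {Γ : Subgroup (G ≃g G)} {n : ℕ}

/-- The law of `w(a)|_{Shadow[e]}` under the restriction of `μ` to `awayTraceSetOf`. -/
noncomputable def restrictedLaw (hG : G.Connected) (μ : Measure (G ≃g G)) (O : V)
    (w : Fin (n + 1) → Letter Γ) (e : G.Dart) (𝒯 : Fin (n + 2) → G.Dart)
    (P : Set (Fin (n + 2) → V)) : Measure (shadowAut e) :=
  (μ.restrict (awayTraceSetOf O w e 𝒯 P)).map fun a => restrictShadow hG e (wordEval w a)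

theorem measure_shadowCylinder_restrictedLaw [G.LocallyFinite] (hT : G.IsTree)
    (μ : Measure (G ≃g G)) {O : V} {w : Fin (n + 1) → Letter Γ} {e : G.Dart}
    {𝒯 : Fin (n + 2) → G.Dart} (D : TraceData O w e 𝒯) (P : Set (Fin (n + 2) → V)) (r : ℕ)
    {κ : shadowAut e} {κ' : V → V} (hκ : ∀ v : Shadow G e, κ' v = κ.1 v) :
    restrictedLaw hT.connected μ O w e 𝒯 P (shadowCylinder r κ) =
      μ (evalCylinder O w e 𝒯 P (shadowBall G e r) κ') := by
  have hc := continuous_restrictShadow_wordEval hT.connected e w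
  have hm := (isOpen_shadowCylinder hT.connected r κ)
  rw [restrictedLaw, Measure.map_apply hc.measurable hm.measurableSet,
    Measure.restrict_apply (hm.preimage hc).measurableSet]
  congr 1
  ext a
  rw [Set.inter_comm]
  refine and_congr_right fun ha => ?_
  have hw := D.dartMap_wordEval ha.1.1
  constructor
  · intro h v hv
    have h1 := h ⟨v, hv.1⟩ hv.2
    rw [Subtype.ext_iff, restrictShadow_apply hT.connected hw] at h1
    rw [hκ ⟨v, hv.1⟩]
    exact h1
  · intro h v hv
    apply Subtype.ext
    rw [restrictShadow_apply hT.connected hw, ← hκ]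
    exact h v ⟨v.2, hv⟩

theorem measure_shadowCylinder_restrictedLaw_eq [G.LocallyFinite] (hT : G.IsTree)
    {O : V} {μ : Measure (G ≃g G)} [μ.IsMulLeftInvariant] (hμ : μ {a | a O = O} < ⊤)
    {w : Fin (n + 1) → Letter Γ} {e : G.Dart} {𝒯 : Fin (n + 2) → G.Dart}
    (D : TraceData O w e 𝒯) (hsite : ∃ i s, IsSite w i s) (P : Set (Fin (n + 2) → V))
    (hfin : μ (awayTraceSetOf O w e 𝒯 P) < ⊤) (r : ℕ) (κ κ' : shadowAut e) :
    restrictedLaw hT.connected μ O w e 𝒯 P (shadowCylinder r κ) =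
      restrictedLaw hT.connected μ O w e 𝒯 P (shadowCylinder r κ') := by
  have : IsFiniteMeasure (μ.restrict (awayTraceSetOf O w e 𝒯 P)) := ⟨by
    rwa [Measure.restrict_apply_univ]⟩
  have : IsFiniteMeasure (restrictedLaw hT.connected μ O w e 𝒯 P) := by
    unfold restrictedLaw
    infer_instance
  refine measure_shadowCylinder_eq hT.connected ?_ r κ κ'
  have hle : ∀ m (κ κ' : shadowAut e), κ' ∈ shadowCylinder m κ →
      restrictedLaw hT.connected μ O w e 𝒯 P (shadowCylinder (m + 1) κ) ≤
        restrictedLaw hT.connected μ O w e 𝒯 P (shadowCylinder (m + 1) κ') := by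
    intro m κ κ' h
    obtain ⟨k, -, hk⟩ := exists_extension hT D.pos_edge κ
    obtain ⟨θ, hθ, hθ'⟩ := exists_extension hT D.pos_edge (κ⁻¹ * κ')
    have hθm : SupportedBelow e m θ := by
      intro v hv
      by_cases hd : G.dist e.snd v ≤ m
      · right
        rw [hθ' ⟨v, hv⟩]
        change ((κ.1⁻¹ (κ'.1 ⟨v, hv⟩) : Shadow G e) : V) = v
        rw [h ⟨v, hv⟩ hd, RelIso.inv_apply_self]
      · exact Or.inl (by omega)
    rw [measure_shadowCylinder_restrictedLaw hT μ D P (m + 1) hk,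
      measure_shadowCylinder_restrictedLaw hT μ D P (m + 1) (κ := κ') (κ' := k ∘ θ)]
    · exact measure_evalCylinder_le hT hμ D hsite P hθ hθm k
    · intro v
      rw [Function.comp_apply, hθ', hk]
      change ((κ.1 (κ.1⁻¹ (κ'.1 v)) : Shadow G e) : V) = _
      rw [RelIso.apply_inv_self]
  intro m κ κ' h
  exact le_antisymm (hle m κ κ' h) (hle m κ' κ fun v hv => (h v hv).symm)

end RestrictedLaw

section LevelTransitivity

variable {V : Type*} {G : SimpleGraph V}

theorem parent_apply (hT : G.IsTree) {O : V} {φ : G ≃g G} (hφ : φ O = O) (x : V) :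
    parent G O (φ x) = φ (parent G O x) := by
  by_cases hx : x = O
  · rw [hx, parent_root, hφ, parent_root]
  · obtain ⟨h1, h2⟩ := parent_spec hT.connected hx
    refine parent_eq hT (φ.map_rel_iff.2 h1) ?_
    nth_rewrite 1 [← hφ]
    nth_rewrite 2 [← hφ]
    rw [dist_iso φ hT.connected, dist_iso φ hT.connected, h2]

theorem apply_mem_children (hT : G.IsTree) {O p x : V} {φ : G ≃g G} (hφ : φ O = O)
    (hx : x ∈ children G O p) : φ x ∈ children G O (φ p) := by
  obtain ⟨h1, rfl⟩ := hx
  refine ⟨fun h => h1 (φ.injective (h.trans hφ.symm)), parent_apply hT hφ x⟩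

/-- The stabilizer of `O` and `e` is transitive on the levels of `Shadow[e]`. -/
theorem exists_automorphism_shadow [G.LocallyFinite] (hT : G.IsTree) {d : ℕ}
    (hreg : G.IsRegularOfDegree d) {O : V} {e : G.Dart} (he : PosDart G O e) (m : ℕ) {x y : V}
    (hx : x ∈ Shadow G e) (hy : y ∈ Shadow G e) (hxm : G.dist e.snd x = m)
    (hym : G.dist e.snd y = m) :
    ∃ φ : G ≃g G, φ O = O ∧ dartMap φ e = e ∧ φ x = y := by
  classical
  have hG := hT.connected
  induction m generalizing x y with
  | zero =>
    refine ⟨1, rfl, rfl, ?_⟩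
    rw [← hG.dist_eq_zero_iff.1 hxm, ← hG.dist_eq_zero_iff.1 hym]
    rfl
  | succ m ih =>
    have hne : ∀ {z}, G.dist e.snd z = m + 1 → z ≠ e.snd := by
      rintro z hz rfl
      simp at hz
    have hzO : ∀ {z}, z ∈ Shadow G e → z ≠ O := by
      rintro z hz rfl
      exact root_notMem_shadow hT he hz
    have hpar : ∀ {z}, z ∈ Shadow G e → G.dist e.snd z = m + 1 →
        parent G O z ∈ Shadow G e ∧ G.dist e.snd (parent G O z) = m := by
      intro z hz hzm
      have h1 := parent_mem_shadow hT he hz (hne hzm)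
      refine ⟨h1, ?_⟩
      have h2 := dist_of_mem_shadow hT he h1
      have h3 := dist_of_mem_shadow hT he hz
      have h4 := (parent_spec hG (hzO hz)).2
      omega
    obtain ⟨φ, hφO, hφe, hφx⟩ := ih (hpar hx hxm).1 (hpar hy hym).1 (hpar hx hxm).2 (hpar hy hym).2
    set q := parent G O y with hq
    have hxq : φ x ∈ children G O q := by
      rw [← hφx]
      exact apply_mem_children hT hφO ⟨hzO hx, rfl⟩
    have hyq : y ∈ children G O q := ⟨hzO hy, rfl⟩
    obtain ⟨ψ, hψ, hψ'⟩ := exists_automorphism_permuting hT hreg O (G.dist O q)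
      (fun p => if p = q then Equiv.swap (φ x) y else id) (by
        intro p _
        by_cases hpq : p = q
        · rw [if_pos hpq, hpq]
          have hmaps : Set.MapsTo (Equiv.swap (φ x) y) (children G O q) (children G O q) := by
            intro z hz
            by_cases h1 : z = φ x
            · rw [h1, Equiv.swap_apply_left]
              exact hyq
            · by_cases h2 : z = y
              · rw [h2, Equiv.swap_apply_right]
                exact hxq
              · rwa [Equiv.swap_apply_of_ne_of_ne h1 h2]
          refine ⟨hmaps, (Equiv.injective _).injOn, fun z hz => ⟨_, hmaps hz, ?_⟩⟩
          have := (Equiv.swap (φ x) y).symm_apply_apply z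
          rwa [Equiv.symm_swap] at this
        · rw [if_neg hpq]
          exact Set.bijOn_id _)
    have hqd := dist_of_mem_shadow hT he (hpar hy hym).1
    rw [← hq] at hqd
    have hed := he.dist_snd hT
    refine ⟨ψ * φ, ?_, ?_, ?_⟩
    · rw [RelIso.mul_apply, hφO]
      exact hψ O (by simp)
    · obtain ⟨h1, h2⟩ := dartMap_eq_iff.1 hφe
      refine dartMap_eq_iff.2 ⟨?_, ?_⟩
      · rw [RelIso.mul_apply, h1]
        exact hψ _ (by omega)
      · rw [RelIso.mul_apply, h2]
        exact hψ _ (by omega)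
    · rw [RelIso.mul_apply, hψ' q _ rfl hxq, if_pos rfl, Equiv.swap_apply_left]

end LevelTransitivity

section FixedVertices

variable {V : Type*} {G : SimpleGraph V} {e : G.Dart}

theorem isOpen_shadowAut_apply_eq (x y : Shadow G e) : IsOpen {f : shadowAut e | f.1 x = y} :=
  isOpen_eval_eq (subgroup_topology_eq (shadowAut e)) x y

theorem restrictShadow_apply_eq (hG : G.Connected) {f : G ≃g G} (h : dartMap f e = e)
    {x y : Shadow G e} (hxy : f x = y) : (restrictShadow hG e f).1 x = y :=
  Subtype.ext ((restrictShadow_apply hG h x).trans hxy)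

theorem exists_extension_fixing (hT : G.IsTree) {O : V} (he : PosDart G O e) (g : shadowAut e) :
    ∃ θ : G ≃g G, θ O = O ∧ dartMap θ e = e ∧ ∀ v : Shadow G e, θ v = g.1 v := by
  obtain ⟨θ, h1, h2⟩ := exists_extension hT he g
  refine ⟨θ, h1 O (root_notMem_shadow hT he), dartMap_eq_iff.2 ⟨h1 _ (fst_notMem_shadow e), ?_⟩, h2⟩
  exact (h2 (shadowRoot e)).trans (congrArg Subtype.val g.2)

theorem fixed_parent (hT : G.IsTree) {O : V} (he : PosDart G O e) {g : shadowAut e}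
    {z p : Shadow G e} (hp : parent G O z = p) (hz : g.1 z = z) : g.1 p = p := by
  obtain ⟨θ, h1, -, h2⟩ := exists_extension_fixing hT he g
  apply Subtype.ext
  rw [← h2, ← hp, ← parent_apply hT h1, h2, hz]

variable [G.LocallyFinite]

theorem finite_shadow_level (hG : G.Connected) (e : G.Dart) (m : ℕ) :
    {v : Shadow G e | G.dist e.snd v = m}.Finite :=
  (finite_shadow_level_le hG e m).subset fun _ hv => le_of_eq hv

/-- The vertices of `Shadow[e]` at distance `m` from its root. -/
noncomputable def shadowLevel (hG : G.Connected) (e : G.Dart) (m : ℕ) : Finset (Shadow G e) :=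
  (finite_shadow_level hG e m).toFinset

theorem mem_shadowLevel (hG : G.Connected) {m : ℕ} {v : Shadow G e} :
    v ∈ shadowLevel hG e m ↔ G.dist e.snd v = m :=
  (finite_shadow_level hG e m).mem_toFinset

theorem shadowAut_mem_level (hT : G.IsTree) {O : V} (he : PosDart G O e) (g : shadowAut e) {m : ℕ}
    {x : Shadow G e} (hx : x ∈ shadowLevel hT.connected e m) :
    g.1 x ∈ shadowLevel hT.connected e m := by
  obtain ⟨θ, -, h1, h2⟩ := exists_extension_fixing hT he g
  rw [mem_shadowLevel] at hx ⊢
  rw [← h2, dist_snd_apply hT.connected h1, hx]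

/-- The expected number of fixed vertices on a level. -/
theorem sum_measure_fixed_le (hT : G.IsTree) {d : ℕ} (hreg : G.IsRegularOfDegree d) {O : V}
    (he : PosDart G O e) (ν : Measure (shadowAut e)) [ν.IsMulLeftInvariant] (m : ℕ) :
    ∑ x ∈ shadowLevel hT.connected e m, ν {f | f.1 x = x} ≤ ν Set.univ := by
  classical
  set Λ := shadowLevel hT.connected e m with hΛ
  have heq : ∀ x ∈ Λ, ∀ y ∈ Λ, ν {f | f.1 x = y} = ν {f | f.1 x = x} := by
    intro x hx y hy
    rw [hΛ, mem_shadowLevel] at hx hy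
    obtain ⟨φ, -, hφ, hxy⟩ := exists_automorphism_shadow hT hreg he m x.2 y.2 hx hy
    have hg := restrictShadow_apply_eq hT.connected hφ hxy
    rw [← measure_preimage_mul ν (restrictShadow hT.connected e φ)]
    congr 1
    ext f
    change (restrictShadow hT.connected e φ).1 (f.1 x) = y ↔ f.1 x = x
    nth_rewrite 1 [← hg]
    exact (restrictShadow hT.connected e φ).1.injective.eq_iff
  have hone : ∀ x ∈ Λ, (Λ.card : ENNReal) * ν {f | f.1 x = x} = ν Set.univ := by
    intro x hx
    have hU : (Set.univ : Set (shadowAut e)) = ⋃ y ∈ Λ, {f | f.1 x = y} := by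
      refine (Set.eq_univ_of_forall fun f => ?_).symm
      simp only [Set.mem_iUnion]
      exact ⟨f.1 x, shadowAut_mem_level hT he f hx, rfl⟩
    rw [hU, measure_biUnion_finset]
    · rw [Finset.sum_congr rfl (heq x hx), Finset.sum_const, nsmul_eq_mul]
    · intro y _ z _ hyz
      exact Set.disjoint_left.2 fun f hf hf' => hyz (hf.symm.trans hf')
    · exact fun y _ => (isOpen_shadowAut_apply_eq x y).measurableSet
  by_cases hemp : Λ.card = 0
  · rw [Finset.card_eq_zero.1 hemp]
    simp
  · have h1 : (Λ.card : ENNReal) * ∑ x ∈ Λ, ν {f | f.1 x = x} = Λ.card * ν Set.univ := by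
      rw [Finset.mul_sum, Finset.sum_congr rfl hone, Finset.sum_const, nsmul_eq_mul]
    exact ((ENNReal.mul_right_inj (by exact_mod_cast hemp) (ENNReal.natCast_ne_top _)).1 h1).le

theorem exists_perm_without_fixed_points {α : Type*} [Finite α] (h : 2 ≤ Nat.card α) :
    ∃ c : Equiv.Perm α, ∀ x, c x ≠ x := by
  obtain ⟨k, hk⟩ := Nat.exists_eq_add_of_le' h
  let ε : α ≃ Fin (k + 2) := Finite.equivFinOfCardEq hk
  refine ⟨(ε.trans (finRotate (k + 2))).trans ε.symm, fun x hx => ?_⟩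
  have h1 : finRotate (k + 2) (ε x) = ε x := by
    rw [← ε.symm_apply_eq]
    exact hx
  rw [finRotate_apply] at h1
  simp at h1

/-- The automorphisms of `Shadow[e]` with a fixed vertex on level `m`. -/
def fixingLevel (hG : G.Connected) (e : G.Dart) (m : ℕ) : Set (shadowAut e) :=
  {f | ∃ x ∈ shadowLevel hG e m, f.1 x = x}

/-- The automorphisms of `Shadow[e]` whose set of fixed vertices on level `m` is `Q`. -/
def fixedLevelEq (hG : G.Connected) (e : G.Dart) (m : ℕ) (Q : Finset (Shadow G e)) :
    Set (shadowAut e) :=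
  {f | ∀ x ∈ shadowLevel hG e m, (f.1 x = x ↔ x ∈ Q)}

theorem measurableSet_fixingLevel (hG : G.Connected) (m : ℕ) :
    MeasurableSet (fixingLevel hG e m) := by
  have : fixingLevel hG e m = ⋃ x ∈ shadowLevel hG e m, {f | f.1 x = x} := by
    ext f
    simp [fixingLevel]
  rw [this]
  exact (isOpen_biUnion fun x _ => isOpen_shadowAut_apply_eq x x).measurableSet

theorem measurableSet_fixedLevelEq (hG : G.Connected) (m : ℕ) (Q : Finset (Shadow G e)) :
    MeasurableSet (fixedLevelEq hG e m Q) := by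
  have : fixedLevelEq hG e m Q = ⋂ x ∈ shadowLevel hG e m, {f | f.1 x = x ↔ x ∈ Q} := by
    ext f
    simp [fixedLevelEq]
  rw [this]
  refine Finset.measurableSet_biInter _ fun x _ => ?_
  by_cases hx : x ∈ Q
  · simp only [hx, iff_true]
    exact (isOpen_shadowAut_apply_eq x x).measurableSet
  · simp only [hx, iff_false]
    exact (isOpen_shadowAut_apply_eq x x).measurableSet.compl

theorem parent_mem_level (hT : G.IsTree) {O : V} (he : PosDart G O e) {m : ℕ} {z : Shadow G e}
    (hz : z ∈ shadowLevel hT.connected e (m + 1)) :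
    ∃ p ∈ shadowLevel hT.connected e m, parent G O z = p := by
  rw [mem_shadowLevel] at hz
  have hne : (z : V) ≠ e.snd := by
    intro h
    rw [h] at hz
    simp at hz
  have hzO : (z : V) ≠ O := fun h => root_notMem_shadow hT he (h ▸ z.2)
  have h1 := parent_mem_shadow hT he z.2 hne
  refine ⟨⟨_, h1⟩, ?_, rfl⟩
  rw [mem_shadowLevel]
  have h2 := dist_of_mem_shadow hT he h1
  have h3 := dist_of_mem_shadow hT he z.2
  have h4 := (parent_spec hT.connected hzO).2
  dsimp only
  omega

theorem fixingLevel_succ_subset (hT : G.IsTree) {O : V} (he : PosDart G O e) (m : ℕ) :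
    fixingLevel hT.connected e (m + 1) ⊆ fixingLevel hT.connected e m := by
  rintro f ⟨z, hz, hfz⟩
  obtain ⟨p, hp, hzp⟩ := parent_mem_level hT he hz
  exact ⟨p, hp, fixed_parent hT he hzp hfz⟩

/-- With probability bounded below in terms of the number of fixed vertices on level `m`, there
is no fixed vertex on level `m + 1`. -/
theorem measure_fixedLevelEq_le (hT : G.IsTree) {d : ℕ} (hd : 3 ≤ d)
    (hreg : G.IsRegularOfDegree d) {O : V} (he : PosDart G O e) (ν : Measure (shadowAut e))
    [ν.IsMulLeftInvariant] (m : ℕ) {Q : Finset (Shadow G e)}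
    (hQ : Q ⊆ shadowLevel hT.connected e m) :
    ν (fixedLevelEq hT.connected e m Q) ≤ (((d - 1).factorial ^ Q.card : ℕ) : ENNReal) *
      ν (fixedLevelEq hT.connected e m Q \ fixingLevel hT.connected e (m + 1)) := by
  classical
  have hG := hT.connected
  have hneO : ∀ p : Shadow G e, (p : V) ≠ O := fun p h => root_notMem_shadow hT he (h ▸ p.2)
  have hfinc : ∀ p : V, Finite (children G O p) := fun p => (finite_children hT O p).to_subtype
  have hfint : ∀ p : V, Fintype (children G O p) := fun p => Fintype.ofFinite _
  have hcard : ∀ p : Shadow G e, Nat.card (children G O (p : V)) = d - 1 := fun p => by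
    rw [Nat.card_coe_set_eq, ncard_children hT hreg (hneO p)]
  have hdist : ∀ p ∈ Q, G.dist O p = G.dist O e.snd + m := by
    intro p hp
    have h1 := hQ hp
    rw [mem_shadowLevel] at h1
    rw [dist_of_mem_shadow hT he p.2, h1]
  have hext : ∀ ι : (p : Q) → Equiv.Perm (children G O (p.1 : V)), ∃ g : shadowAut e,
      (∀ x ∈ shadowLevel hG e m, g.1 x = x) ∧
      ∀ (p : Q) (z : Shadow G e) (hz : (z : V) ∈ children G O (p.1 : V)),
        (g.1 z : V) = ι p ⟨z, hz⟩ := by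
    intro ι
    obtain ⟨φ, hφ, hφ'⟩ := exists_automorphism_permuting hT hreg O (G.dist O e.snd + m)
      (fun p => if hp : ∃ q : Q, (q.1 : V) = p then
        (Equiv.Perm.ofSubtype (ι hp.choose) : Equiv.Perm V) else id) (by
        intro p _
        split_ifs with hp
        · have hp' := hp.choose_spec
          set q := hp.choose
          rw [← hp']
          have hmaps : ∀ σ : Equiv.Perm (children G O (q.1 : V)),
              Set.MapsTo (Equiv.Perm.ofSubtype σ : Equiv.Perm V) (children G O (q.1 : V))
                (children G O (q.1 : V)) := by
            intro σ z hz
            rw [Equiv.Perm.ofSubtype_apply_of_mem σ hz]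
            exact (σ ⟨z, hz⟩).2
          refine ⟨hmaps _, (Equiv.injective _).injOn, fun z hz => ⟨_, hmaps (ι q)⁻¹ hz, ?_⟩⟩
          rw [map_inv]
          exact Equiv.apply_symm_apply _ z
        · exact Set.bijOn_id _)
    have hed := he.dist_snd hT
    have hφe : dartMap φ e = e :=
      dartMap_eq_iff.2 ⟨hφ _ (by omega), hφ _ (by omega)⟩
    refine ⟨restrictShadow hG e φ, ?_, ?_⟩
    · intro x hx
      apply restrictShadow_apply_eq hG hφe
      apply hφ
      rw [mem_shadowLevel] at hx
      rw [dist_of_mem_shadow hT he x.2, hx]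
    · intro p z hz
      have hex : ∃ q : Q, (q.1 : V) = p.1 := ⟨p, rfl⟩
      have hchoose : hex.choose = p := by
        apply Subtype.ext
        apply Subtype.ext
        exact hex.choose_spec
      rw [restrictShadow_apply hG hφe, hφ' p.1 z (hdist p.1 p.2) hz, dif_pos hex, hchoose,
        Equiv.Perm.ofSubtype_apply_of_mem _ hz]
  choose g hg hg' using hext
  have hcover : fixedLevelEq hG e m Q ⊆ ⋃ ι, (fun f => g ι * f) ⁻¹'
      (fixedLevelEq hG e m Q \ fixingLevel hG e (m + 1)) := by
    intro f hf
    obtain ⟨θ, hθO, -, hθ⟩ := exists_extension_fixing hT he f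
    have hperm : ∀ p : Q, ∃ π : Equiv.Perm (children G O (p.1 : V)), ∀ z, (π z : V) = θ z := by
      intro p
      have hfp : f.1 p.1 = p.1 := (hf p.1 (hQ p.2)).2 p.2
      have hθp : θ (p.1 : V) = p.1 := by rw [hθ, hfp]
      have hmap : ∀ z ∈ children G O (p.1 : V), θ z ∈ children G O (p.1 : V) := by
        intro z hz
        have := apply_mem_children hT hθO hz
        rwa [hθp] at this
      let F : children G O (p.1 : V) → children G O (p.1 : V) := fun z => ⟨θ z, hmap z z.2⟩
      have hF : Function.Injective F := fun z z' h =>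
        Subtype.ext (θ.injective (congrArg Subtype.val h))
      exact ⟨Equiv.ofBijective F (Finite.injective_iff_bijective.1 hF), fun z => rfl⟩
    choose π hπ using hperm
    have hder : ∀ p : Q, ∃ c : Equiv.Perm (children G O (p.1 : V)), ∀ x, c x ≠ x := fun p =>
      exists_perm_without_fixed_points (by rw [hcard]; omega)
    choose c hc using hder
    set ι : (p : Q) → Equiv.Perm (children G O (p.1 : V)) := fun p => (π p).symm.trans (c p) with hι
    refine Set.mem_iUnion.2 ⟨ι, ?_⟩
    have hsame : ∀ x ∈ shadowLevel hG e m, (g ι * f).1 x = f.1 x := fun x hx =>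
      hg ι _ (shadowAut_mem_level hT he f hx)
    refine ⟨fun x hx => ?_, ?_⟩
    · change (g ι * f).1 x = x ↔ x ∈ Q
      rw [hsame x hx]
      exact hf x hx
    · rintro ⟨z, hz, hfz⟩
      obtain ⟨p, hp, hzp⟩ := parent_mem_level hT he hz
      have hfp := fixed_parent hT he hzp hfz
      have hpQ : p ∈ Q := by
        rw [← hf p hp, ← hsame p hp]
        exact hfp
      have hzc : (z : V) ∈ children G O ((⟨p, hpQ⟩ : Q).1 : V) := ⟨hneO z, hzp⟩
      have hfz' : (f.1 z : V) = π ⟨p, hpQ⟩ ⟨z, hzc⟩ := by rw [hπ, hθ]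
      have hfzc : (f.1 z : V) ∈ children G O ((⟨p, hpQ⟩ : Q).1 : V) := by
        rw [hfz']
        exact (π ⟨p, hpQ⟩ ⟨z, hzc⟩).2
      have h1 := hg' ι ⟨p, hpQ⟩ (f.1 z) hfzc
      have h2 : (⟨f.1 z, hfzc⟩ : children G O ((⟨p, hpQ⟩ : Q).1 : V)) = π ⟨p, hpQ⟩ ⟨z, hzc⟩ :=
        Subtype.ext hfz'
      rw [h2, hι, Equiv.trans_apply, Equiv.symm_apply_apply] at h1
      refine hc ⟨p, hpQ⟩ ⟨z, hzc⟩ (Subtype.ext ?_)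
      rw [← h1]
      exact congrArg Subtype.val hfz
  refine (measure_mono hcover).trans ((measure_iUnion_le _).trans ?_)
  simp only [measure_preimage_mul]
  rw [tsum_fintype, Finset.sum_const, nsmul_eq_mul, Finset.card_univ, Fintype.card_pi]
  refine mul_le_mul_left ?_ _
  rw [Finset.prod_congr rfl (g := fun _ => (d - 1).factorial)]
  · rw [Finset.prod_const, Finset.card_univ, Fintype.card_coe]
  · intro p _
    rw [Fintype.card_perm, ← Nat.card_eq_fintype_card, hcard]

end FixedVertices

section AlmostSureExtinction

variable {V : Type*} {G : SimpleGraph V} [G.LocallyFinite] {e : G.Dart}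

open scoped Classical in
/-- The set of fixed vertices on level `m` of an automorphism of `Shadow[e]`. -/
noncomputable def fixedOnLevel (hG : G.Connected) (m : ℕ) (f : shadowAut e) :
    Finset (Shadow G e) :=
  {x ∈ shadowLevel hG e m | f.1 x = x}

theorem mem_fixedOnLevel (hG : G.Connected) {m : ℕ} {f : shadowAut e} {x : Shadow G e} :
    x ∈ fixedOnLevel hG m f ↔ x ∈ shadowLevel hG e m ∧ f.1 x = x := by
  classical
  simp [fixedOnLevel]

theorem mem_fixedLevelEq_fixedOnLevel (hG : G.Connected) (m : ℕ) (f : shadowAut e) :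
    f ∈ fixedLevelEq hG e m (fixedOnLevel hG m f) := by
  intro x hx
  rw [mem_fixedOnLevel]
  exact ⟨fun h => ⟨hx, h⟩, fun h => h.2⟩

theorem fixedOnLevel_eq (hG : G.Connected) {m : ℕ} {f : shadowAut e} {Q : Finset (Shadow G e)}
    (hQ : Q ⊆ shadowLevel hG e m) (hf : f ∈ fixedLevelEq hG e m Q) : fixedOnLevel hG m f = Q := by
  ext x
  rw [mem_fixedOnLevel]
  constructor
  · rintro ⟨h1, h2⟩
    exact (hf x h1).1 h2
  · intro h
    exact ⟨hQ h, (hf x (hQ h)).2 h⟩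

/-- Markov's inequality for the number of fixed vertices on a level. -/
theorem mul_measure_card_fixed_le (hT : G.IsTree) {d : ℕ} (hreg : G.IsRegularOfDegree d) {O : V}
    (he : PosDart G O e) (ν : Measure (shadowAut e)) [ν.IsMulLeftInvariant] (m k : ℕ) :
    (k : ENNReal) * ν {f | k ≤ (fixedOnLevel hT.connected m f).card} ≤ ν Set.univ := by
  classical
  have hcard : ∀ f : shadowAut e, ((fixedOnLevel hT.connected m f).card : ENNReal) =
      ∑ x ∈ shadowLevel hT.connected e m, Set.indicator {f : shadowAut e | f.1 x = x} 1 f := by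
    intro f
    rw [fixedOnLevel, Finset.card_filter]
    push_cast
    refine Finset.sum_congr rfl fun x _ => ?_
    simp [Set.indicator_apply]
  refine le_trans ?_ (sum_measure_fixed_le hT hreg he ν m)
  have hmeas : ∀ x : Shadow G e, MeasurableSet {f : shadowAut e | f.1 x = x} := fun x =>
    (isOpen_shadowAut_apply_eq x x).measurableSet
  calc (k : ENNReal) * ν {f | k ≤ (fixedOnLevel hT.connected m f).card}
      ≤ (k : ENNReal) * ν {f | (k : ENNReal) ≤ ∑ x ∈ shadowLevel hT.connected e m,
          Set.indicator {f : shadowAut e | f.1 x = x} 1 f} := by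
        refine mul_le_mul_right (measure_mono fun f hf => ?_) _
        change (k : ENNReal) ≤ _
        rw [← hcard]
        exact_mod_cast hf
    _ ≤ ∫⁻ f, ∑ x ∈ shadowLevel hT.connected e m,
          Set.indicator {f : shadowAut e | f.1 x = x} 1 f ∂ν := by
        apply mul_meas_ge_le_lintegral
        exact Finset.measurable_fun_sum _ fun x _ => measurable_one.indicator (hmeas x)
    _ = ∑ x ∈ shadowLevel hT.connected e m, ν {f | f.1 x = x} := by
        rw [lintegral_finsetSum _ fun x _ => measurable_one.indicator (hmeas x)]
        refine Finset.sum_congr rfl fun x _ => ?_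
        rw [lintegral_indicator_one (hmeas x)]

theorem measure_fixing_card_le (hT : G.IsTree) {d : ℕ} (hd : 3 ≤ d)
    (hreg : G.IsRegularOfDegree d) {O : V} (he : PosDart G O e) (ν : Measure (shadowAut e))
    [ν.IsMulLeftInvariant] (m k : ℕ) :
    ν {f ∈ fixingLevel hT.connected e m | (fixedOnLevel hT.connected m f).card ≤ k} ≤
      (((d - 1).factorial ^ k : ℕ) : ENNReal) *
        ν (fixingLevel hT.connected e m \ fixingLevel hT.connected e (m + 1)) := by
  classical
  have hG := hT.connected
  set 𝒬 : Finset (Finset (Shadow G e)) :=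
    {Q ∈ (shadowLevel hG e m).powerset | Q.Nonempty ∧ Q.card ≤ k} with h𝒬
  have hmem : ∀ {Q}, Q ∈ 𝒬 → Q ⊆ shadowLevel hG e m ∧ Q.Nonempty ∧ Q.card ≤ k := by
    intro Q hQ
    rw [h𝒬, Finset.mem_filter, Finset.mem_powerset] at hQ
    exact hQ
  have hsub : {f ∈ fixingLevel hG e m | (fixedOnLevel hG m f).card ≤ k} ⊆
      ⋃ Q ∈ 𝒬, fixedLevelEq hG e m Q := by
    rintro f ⟨⟨x, hx, hfx⟩, hk⟩
    simp only [Set.mem_iUnion]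
    refine ⟨fixedOnLevel hG m f, ?_, mem_fixedLevelEq_fixedOnLevel hG m f⟩
    rw [h𝒬, Finset.mem_filter, Finset.mem_powerset]
    exact ⟨fun y hy => ((mem_fixedOnLevel hG).1 hy).1,
      ⟨x, (mem_fixedOnLevel hG).2 ⟨hx, hfx⟩⟩, hk⟩
  calc ν {f ∈ fixingLevel hG e m | (fixedOnLevel hG m f).card ≤ k}
      ≤ ∑ Q ∈ 𝒬, ν (fixedLevelEq hG e m Q) :=
        (measure_mono hsub).trans (measure_biUnion_finset_le _ _)
    _ ≤ ∑ Q ∈ 𝒬, (((d - 1).factorial ^ k : ℕ) : ENNReal) *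
          ν (fixedLevelEq hG e m Q \ fixingLevel hG e (m + 1)) := by
        refine Finset.sum_le_sum fun Q hQ => ?_
        refine (measure_fixedLevelEq_le hT hd hreg he ν m (hmem hQ).1).trans ?_
        refine mul_le_mul_left ?_ _
        exact_mod_cast Nat.pow_le_pow_right (Nat.factorial_pos _) (hmem hQ).2.2
    _ = (((d - 1).factorial ^ k : ℕ) : ENNReal) *
          ν (⋃ Q ∈ 𝒬, fixedLevelEq hG e m Q \ fixingLevel hG e (m + 1)) := by
        rw [← Finset.mul_sum, measure_biUnion_finset]
        · intro Q hQ Q' hQ' hne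
          refine Set.disjoint_left.2 fun f hf hf' => hne ?_
          rw [← fixedOnLevel_eq hG (hmem hQ).1 hf.1, fixedOnLevel_eq hG (hmem hQ').1 hf'.1]
        · exact fun Q _ => (measurableSet_fixedLevelEq hG m Q).diff
            (measurableSet_fixingLevel hG (m + 1))
    _ ≤ _ := by
        refine mul_le_mul_right (measure_mono ?_) _
        refine Set.iUnion₂_subset fun Q hQ f hf => ⟨?_, hf.2⟩
        obtain ⟨h1, ⟨x, hx⟩, -⟩ := hmem hQ
        exact ⟨x, h1 hx, (hf.1 x (h1 hx)).2 hx⟩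

/-- A random automorphism of `Shadow[e]` has almost surely only finitely many fixed vertices. -/
theorem ae_finite_fixed (hT : G.IsTree) {d : ℕ} (hd : 3 ≤ d) (hreg : G.IsRegularOfDegree d)
    {O : V} (he : PosDart G O e) (ν : Measure (shadowAut e)) [ν.IsMulLeftInvariant]
    [IsFiniteMeasure ν] : ∀ᵐ f ∂ν, {v : Shadow G e | f.1 v = v}.Finite := by
  have hG := hT.connected
  set D : ℕ → Set (shadowAut e) := fixingLevel hG e with hD
  have hanti : Antitone D := antitone_nat_of_succ_le fun m => fixingLevel_succ_subset hT he m
  have hzero : ν.real (⋂ m, D m) = 0 := by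
    by_contra hne
    set δ := ν.real (⋂ m, D m) with hδ
    have hδpos : 0 < δ := lt_of_le_of_ne measureReal_nonneg (Ne.symm hne)
    obtain ⟨k, hk⟩ := exists_nat_gt (2 * ν.real Set.univ / δ)
    have hk' : 2 * ν.real Set.univ < (k + 1) * δ := by
      rw [div_lt_iff₀ hδpos] at hk
      nlinarith
    set N : ℝ := (((d - 1).factorial ^ k : ℕ) : ℝ) with hN
    have hN0 : 0 < N := by
      rw [hN]
      exact_mod_cast pow_pos (Nat.factorial_pos _) k
    have hstep : ∀ m, δ / 2 ≤ N * (ν.real (D m) - ν.real (D (m + 1))) := by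
      intro m
      have h1 : ((k : ℝ) + 1) * ν.real {f | k + 1 ≤ (fixedOnLevel hG m f).card} ≤
          ν.real Set.univ := by
        have h := ENNReal.toReal_mono (measure_ne_top ν _)
          (mul_measure_card_fixed_le hT hreg he ν m (k + 1))
        rw [ENNReal.toReal_mul, ENNReal.toReal_natCast] at h
        push_cast at h
        exact h
      have h2 : ν.real {f ∈ D m | (fixedOnLevel hG m f).card ≤ k} ≤
          N * ν.real (D m \ D (m + 1)) := by
        have h := ENNReal.toReal_mono
          (ENNReal.mul_ne_top (ENNReal.natCast_ne_top _) (measure_ne_top ν _))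
          (measure_fixing_card_le hT hd hreg he ν m k)
        rwa [ENNReal.toReal_mul, ENNReal.toReal_natCast] at h
      have h3 : ν.real (D m \ D (m + 1)) = ν.real (D m) - ν.real (D (m + 1)) :=
        measureReal_sdiff (hanti (Nat.le_succ m)) (measurableSet_fixingLevel hG (m + 1))
      have h4 : ν.real (D m) ≤ ν.real {f ∈ D m | (fixedOnLevel hG m f).card ≤ k} +
          ν.real {f | k + 1 ≤ (fixedOnLevel hG m f).card} := by
        refine (measureReal_mono ?_).trans (measureReal_union_le _ _)
        intro f hf
        by_cases h : (fixedOnLevel hG m f).card ≤ k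
        · exact Or.inl ⟨hf, h⟩
        · exact Or.inr (not_le.1 h)
      have h5 : δ ≤ ν.real (D m) := measureReal_mono (Set.iInter_subset D m)
      have h6 : ν.real {f | k + 1 ≤ (fixedOnLevel hG m f).card} ≤ δ / 2 := by
        have : (0 : ℝ) < k + 1 := by positivity
        nlinarith
      rw [← h3]
      linarith
    have hsum : ∀ M : ℕ, M * (δ / 2) ≤ N * (ν.real (D 0) - ν.real (D M)) := by
      intro M
      induction M with
      | zero => simp
      | succ M ih =>
        have := hstep M
        push_cast
        linarith
    obtain ⟨M, hM⟩ := exists_nat_gt (N * ν.real (D 0) / (δ / 2))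
    rw [div_lt_iff₀ (by positivity)] at hM
    have h1 := hsum M
    have h2 : 0 ≤ N * ν.real (D M) := by positivity
    linarith
  have hzero' : ν (⋂ m, D m) = 0 := by
    rwa [measureReal_eq_zero_iff] at hzero
  rw [ae_iff]
  refine measure_mono_null (fun f hf => ?_) hzero'
  by_contra hmem
  apply hf
  rw [Set.mem_iInter, not_forall] at hmem
  obtain ⟨m, hm⟩ := hmem
  refine (finite_shadow_level_le hG e m).subset fun v hv => ?_
  change G.dist e.snd v ≤ m
  by_contra hlt
  have h1 : f ∈ D (G.dist e.snd v) := ⟨v, (mem_shadowLevel hG).2 rfl, hv⟩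
  exact hm (hanti (not_le.1 hlt).le h1)

end AlmostSureExtinction

section TraceMeasures

variable {V : Type*} {G : SimpleGraph V} {Γ : Subgroup (G ≃g G)} {n : ℕ}

theorem measure_vertexTrace_lt_top [G.LocallyFinite] (hG : G.Connected) {μ : Measure (G ≃g G)}
    [μ.IsMulLeftInvariant] {O : V} (hμ : μ {a | a O = O} < ⊤) {w : Fin (n + 1) → Letter Γ}
    (hsite : ∃ i s, IsSite w i s) (y : V) (p : Fin (n + 2) → V) :
    μ {a | vertexTrace w a y = p} < ⊤ := by
  obtain ⟨i, s, hs⟩ := hsite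
  rcases hs with ⟨hi, -⟩ | ⟨hi, -⟩
  · refine (measure_mono fun a ha => ?_).trans_lt
      (measure_apply_eq_lt_top hG hμ (p i.castSucc) (p i.succ))
    have ha : vertexTrace w a y = p := ha
    change a _ = _
    rw [← ha]
    change a (partialEval w a i y) = partialEval w a (i + 1) y
    rw [partialEval_succ, hi]
    rfl
  · refine (measure_mono fun a ha => ?_).trans_lt
      (measure_apply_eq_lt_top hG hμ (p i.succ) (p i.castSucc))
    have ha : vertexTrace w a y = p := ha
    change a _ = _
    rw [← ha]
    change a (partialEval w a (i + 1) y) = partialEval w a i y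
    rw [partialEval_succ, hi]
    exact RelIso.apply_inv_self a _

theorem ae_finite_fixed_of_traceData [G.LocallyFinite] (hT : G.IsTree) {d : ℕ} (hd : 3 ≤ d)
    (hreg : G.IsRegularOfDegree d) {μ : Measure (G ≃g G)} [μ.IsMulLeftInvariant] {O : V}
    (hμ : μ {a | a O = O} < ⊤) {w : Fin (n + 1) → Letter Γ} (hsite : ∃ i s, IsSite w i s)
    {e : G.Dart} {𝒯 : Fin (n + 2) → G.Dart} (D : TraceData O w e 𝒯) (p : Fin (n + 2) → V) :
    ∀ᵐ a ∂μ, a ∈ awayTraceSetOf O w e 𝒯 {p} →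
      {x : V | x ∈ Shadow G e ∧ wordEval w a x = x}.Finite := by
  have hG := hT.connected
  have hfin : μ (awayTraceSetOf O w e 𝒯 {p}) < ⊤ :=
    (measure_mono fun a ha => ha.2).trans_lt (measure_vertexTrace_lt_top hG hμ hsite O p)
  have : IsFiniteMeasure (μ.restrict (awayTraceSetOf O w e 𝒯 {p})) := ⟨by
    rwa [Measure.restrict_apply_univ]⟩
  have : IsFiniteMeasure (restrictedLaw hG μ O w e 𝒯 {p}) := by
    unfold restrictedLaw
    infer_instance
  have := isMulLeftInvariant_of_shadowCylinder hG
    (measure_shadowCylinder_restrictedLaw_eq hT hμ D hsite {p} hfin)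
  have hae := ae_finite_fixed hT hd hreg D.pos_edge (restrictedLaw hG μ O w e 𝒯 {p})
  have hae' := ae_of_ae_map (continuous_restrictShadow_wordEval hG e w).aemeasurable hae
  rw [ae_restrict_iff' (isOpen_awayTraceSetOf O w e 𝒯 {p}).measurableSet] at hae'
  filter_upwards [hae'] with a ha hmem
  have hw := D.dartMap_wordEval hmem.1.1
  refine ((ha hmem).image Subtype.val).subset ?_
  rintro x ⟨hx, hfx⟩
  exact ⟨⟨x, hx⟩, restrictShadow_apply_eq hG hw hfx, rfl⟩

/-- The trace of a deep edge fixed by `w(a)` inherits the standing assumptions. -/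
theorem TraceData.of_fixed (hT : G.IsTree) {O : V} {w : Fin (n + 1) → Letter Γ} {e : G.Dart}
    {𝒯 : Fin (n + 2) → G.Dart} (D : TraceData O w e 𝒯) {a : G ≃g G} (ha : a ∈ traceSet O w e 𝒯)
    {x : V} (hx : x ∈ Shadow G e) (hxe : x ≠ e.snd) (hxO : x ≠ O) (hfix : wordEval w a x = x) :
    TraceData O w (parentDart hT.connected hxO)
      (edgeTrace w a (parentDart hT.connected hxO)) := by
  have hG := hT.connected
  set f := parentDart hG hxO with hf
  have hpx : parent G O x ∈ Shadow G e := parent_mem_shadow hT D.pos_edge hx hxe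
  have hlev : ∀ (i : Fin (n + 2)) {v : V}, v ∈ Shadow G e → partialEval w a i v ∈ Shadow G (𝒯 i) ∧
      G.dist O (partialEval w a i v) = G.dist O (𝒯 i).snd + G.dist e.snd v := by
    intro i v hv
    have hmap := dartMap_partialEval ha i
    have h1 := (apply_mem_shadow_iff hG hmap v).2 hv
    refine ⟨h1, ?_⟩
    rw [dist_of_mem_shadow hT (D.pos i) h1, dist_snd_apply hG hmap]
  refine ⟨D.reduced, ?_, rfl, ?_, ?_⟩
  · intro i
    change G.dist O (partialEval w a i (parent G O x)) < G.dist O (partialEval w a i x)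
    rw [(hlev i hpx).2, (hlev i hx).2]
    have h1 := (parent_spec hG hxO).2
    have h2 := dist_of_mem_shadow hT D.pos_edge hx
    have h3 := dist_of_mem_shadow hT D.pos_edge hpx
    omega
  · refine dartMap_eq_iff.2 ⟨?_, hfix⟩
    change wordEval w a (parent G O x) = parent G O x
    rw [← parent_apply hT ha.1, hfix]
  · intro i j hij h
    apply D.simple i j hij
    have h1 : partialEval w a i x = partialEval w a j x := congrArg (fun f : G.Dart => f.snd) h
    have h2 := (hlev i hx).2
    have h3 := (hlev j hx).2
    rw [h1] at h2
    refine (D.pos i).eq_of_mem_shadow hT (D.pos j) (by omega) (hlev i hx).1 ?_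
    rw [h1]
    exact (hlev j hx).1

theorem ae_finite_fixed_traceSet [G.LocallyFinite] (hT : G.IsTree) {d : ℕ} (hd : 3 ≤ d)
    (hreg : G.IsRegularOfDegree d) {μ : Measure (G ≃g G)} [μ.IsMulLeftInvariant] {O : V}
    (hμ : μ {a | a O = O} < ⊤) {w : Fin (n + 1) → Letter Γ} (hsite : ∃ i s, IsSite w i s)
    {e : G.Dart} {𝒯 : Fin (n + 2) → G.Dart} (D : TraceData O w e 𝒯) :
    ∀ᵐ a ∂μ, a ∈ traceSet O w e 𝒯 → {x : V | x ∈ Shadow G e ∧ wordEval w a x = x}.Finite := by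
  have hG := hT.connected
  have := countable_vertices hG
  have := countable_darts (G := G)
  have hall : ∀ᵐ a ∂μ, ∀ (f : G.Dart) (𝒯' : Fin (n + 2) → G.Dart) (p : Fin (n + 2) → V),
      TraceData O w f 𝒯' → a ∈ awayTraceSetOf O w f 𝒯' {p} →
      {x : V | x ∈ Shadow G f ∧ wordEval w a x = x}.Finite := by
    simp only [ae_all_iff]
    exact fun f 𝒯' p hD => ae_finite_fixed_of_traceData hT hd hreg hμ hsite hD p
  filter_upwards [hall] with a hall ha
  obtain ⟨M, hM⟩ := (Set.finite_range fun i => G.dist O (vertexTrace w a O i)).bddAbove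
  have hM' : ∀ i, G.dist O (vertexTrace w a O i) ≤ M := fun i => hM ⟨i, rfl⟩
  have hsub : {x : V | x ∈ Shadow G e ∧ wordEval w a x = x} ⊆ shadowBall G e (M + 1) ∪
      ⋃ y ∈ shadowBall G e (M + 1), {x : V | ∃ hyO : y ≠ O, y ≠ e.snd ∧ G.dist e.snd y = M + 1 ∧
        wordEval w a y = y ∧ x ∈ Shadow G (parentDart hG hyO) ∧ wordEval w a x = x} := by
    rintro x ⟨hx, hfx⟩
    by_cases hd : G.dist e.snd x ≤ M + 1
    · exact Or.inl ⟨hx, hd⟩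
    · right
      simp only [Set.mem_iUnion]
      have hkey : ∀ k, k ≤ G.dist e.snd x → (parent G O)^[k] x ∈ Shadow G e ∧
          G.dist e.snd ((parent G O)^[k] x) = G.dist e.snd x - k ∧
          wordEval w a ((parent G O)^[k] x) = (parent G O)^[k] x := by
        intro k
        induction k with
        | zero => exact fun _ => ⟨hx, rfl, hfx⟩
        | succ k ih =>
          intro hk
          obtain ⟨h1, h2, h3⟩ := ih (by omega)
          rw [Function.iterate_succ_apply']
          set z := (parent G O)^[k] x
          have hze : z ≠ e.snd := by
            intro h
            rw [h] at h2
            simp at h2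
            omega
          have hzO : z ≠ O := fun h => root_notMem_shadow hT D.pos_edge (h ▸ h1)
          have h4 := parent_mem_shadow hT D.pos_edge h1 hze
          refine ⟨h4, ?_, ?_⟩
          · have h5 := dist_of_mem_shadow hT D.pos_edge h4
            have h6 := dist_of_mem_shadow hT D.pos_edge h1
            have h7 := (parent_spec hG hzO).2
            omega
          · rw [← parent_apply hT ha.1, h3]
      obtain ⟨h1, h2, h3⟩ := hkey (G.dist e.snd x - (M + 1)) (by omega)
      set y := (parent G O)^[G.dist e.snd x - (M + 1)] x with hy
      have hyM : G.dist e.snd y = M + 1 := by omega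
      have hyO : y ≠ O := fun h => root_notMem_shadow hT D.pos_edge (h ▸ h1)
      refine ⟨y, ⟨h1, hyM.le⟩, hyO, ?_, hyM, h3, ?_, hfx⟩
      · intro h
        rw [h] at hyM
        simp at hyM
      · rw [mem_shadow_iff_iterate hT (posDart_parentDart hG hyO)]
        exact ⟨_, hy.symm⟩
  refine ((finite_shadowBall hG e _).union ((finite_shadowBall hG e _).biUnion fun y hy => ?_)).subset
    hsub
  by_cases hyO : y ≠ O ∧ y ≠ e.snd ∧ G.dist e.snd y = M + 1 ∧ wordEval w a y = y
  · obtain ⟨hyO, hye, hyM, hfy⟩ := hyO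
    have hD := D.of_fixed hT ha hy.1 hye hyO hfy
    refine (hall (parentDart hG hyO) _ (vertexTrace w a O) hD ⟨⟨⟨ha.1, rfl⟩, ?_⟩, rfl⟩).subset ?_
    · intro i j hmem
      have h1 := dist_of_mem_shadow hT (hD.pos j) hmem
      have h2 := hM' i
      have hmap := dartMap_partialEval ha j
      have h3 := dist_of_mem_shadow hT (D.pos j) ((apply_mem_shadow_iff hG hmap y).2 hy.1)
      rw [dist_snd_apply hG hmap] at h3
      have h4 : (edgeTrace w a (parentDart hG hyO) j).snd = partialEval w a j y := rfl
      rw [h4] at h1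
      omega
    · rintro x ⟨_, -, -, -, h1, h2⟩
      exact ⟨h1, h2⟩
  · refine Set.finite_empty.subset ?_
    rintro x ⟨h1, h2, h3, h4, -⟩
    exact hyO ⟨h1, h2, h3, h4⟩

end TraceMeasures

end TreePaper

open TreePaper MeasureTheory
theorem conditioned_restriction_is_haar {V : Type*} (G : SimpleGraph V) [G.LocallyFinite]
    (d : ℕ) (hd : 3 ≤ d) (hT : G.IsTree) (hreg : G.IsRegularOfDegree d) (O : V)
    (c : G.Dart → Fin d) (hc : IsLegalColoring G d c) (hcO : CompatibleColoring G d O c)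
    (μ : Measure (G ≃g G)) [μ.IsHaarMeasure] (hμ : μ {a : G ≃g G | a O = O} = 1)
    (Γ : Subgroup (G ≃g G)) [Countable Γ] (hΓ : ActsAlmostFreely Γ)
    {n : ℕ} (w : Fin (n + 1) → Letter Γ) (hw : CyclicallyReduced w)
    (e : G.Dart) (he : PosDart G O e)
    (𝒯 : Fin (n + 2) → G.Dart) (h𝒯0 : 𝒯 0 = e) (h𝒯last : 𝒯 (Fin.last (n + 1)) = e)
    (h𝒯pos : ∀ i, PosDart G O (𝒯 i))
    (h𝒯simple : ∀ i j : Fin (n + 2), i < j → 𝒯 i = 𝒯 j → i = 0 ∧ j = Fin.last (n + 1))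
    (h𝒯nested : ∀ i j : Fin (n + 1), i ≠ j →
      Disjoint (Shadow G (𝒯 i.castSucc)) (Shadow G (𝒯 j.castSucc)) ∨
      Shadow G (𝒯 i.castSucc) ⊂ Shadow G (𝒯 j.castSucc) ∨
      Shadow G (𝒯 j.castSucc) ⊂ Shadow G (𝒯 i.castSucc))
    (hfin : μ (traceSet O w e 𝒯) < ⊤) :
    (0 < μ (awayTraceSet O w e 𝒯) →
      IsProbabilityMeasure
        (Measure.map (fun a : G ≃g G => restrictShadow hT.connected e (wordEval w a))
          ((μ (awayTraceSet O w e 𝒯))⁻¹ • μ.restrict (awayTraceSet O w e 𝒯))) ∧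
      Measure.IsHaarMeasure
        (Measure.map (fun a : G ≃g G => restrictShadow hT.connected e (wordEval w a))
          ((μ (awayTraceSet O w e 𝒯))⁻¹ • μ.restrict (awayTraceSet O w e 𝒯)))) ∧
    ∀ᵐ a ∂μ.restrict (traceSet O w e 𝒯),
      {x : V | x ∈ Shadow G e ∧ wordEval w a x = x}.Finite := by
  have hG := hT.connected
  have hμtop : μ {a : G ≃g G | a O = O} < ⊤ := by
    rw [hμ]
    exact ENNReal.one_lt_top
  have D : TraceData O w e 𝒯 := ⟨hw, h𝒯pos, h𝒯0, h𝒯last, h𝒯simple⟩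
  rcases exists_isSite_or w hw with hsite | ⟨rfl, γ, hγ, hwγ⟩
  · refine ⟨fun hpos => ?_, ?_⟩
    · set S := awayTraceSet O w e 𝒯 with hS
      have hSfin : μ S < ⊤ := (measure_mono fun a ha => ha.1).trans_lt hfin
      have hSuniv : awayTraceSetOf O w e 𝒯 Set.univ = S := by
        ext a
        simp [awayTraceSetOf, hS]
      have hmeas := (continuous_restrictShadow_wordEval hG e w).measurable
      have hprob : IsProbabilityMeasure ((μ S)⁻¹ • μ.restrict S) := ⟨by
        rw [Measure.smul_apply, Measure.restrict_apply_univ, smul_eq_mul,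
          ENNReal.inv_mul_cancel hpos.ne' hSfin.ne]⟩
      have hprob' := Measure.isProbabilityMeasure_map (μ := (μ S)⁻¹ • μ.restrict S)
        hmeas.aemeasurable
      refine ⟨hprob', ?_⟩
      refine isHaarMeasure_of_shadowCylinder hG (IsProbabilityMeasure.ne_zero _) fun r κ κ' => ?_
      have h1 := measure_shadowCylinder_restrictedLaw_eq hT hμtop D hsite Set.univ
        (by rwa [hSuniv]) r κ κ'
      rw [restrictedLaw, hSuniv] at h1
      rw [Measure.map_smul, Measure.smul_apply, Measure.smul_apply, h1]
    · rw [ae_restrict_iff' (isOpen_traceSet O w e 𝒯).measurableSet]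
      exact ae_finite_fixed_traceSet hT hd hreg hμtop hsite D
  · have heval : ∀ a : G ≃g G, ∀ k, partialEval w a k = partialEval w 1 k := by
      intro a k
      induction k with
      | zero => rfl
      | succ k ih =>
        simp only [partialEval]
        split_ifs with hk
        · have : (⟨k, hk⟩ : Fin 1) = 0 := Fin.ext (by simp; omega)
          rw [ih, this, hwγ]
          rfl
        · exact ih
    have hword : ∀ a : G ≃g G, wordEval w a = γ := by
      intro a
      change partialEval w a ((0 : Fin 1) + 1) = γ
      rw [partialEval_succ, hwγ]
      exact mul_one _
    refine ⟨fun hpos => ?_, ?_⟩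
    · exfalso
      obtain ⟨a₀, ha₀⟩ := nonempty_of_measure_ne_zero hpos.ne'
      have huniv : traceSet O w e 𝒯 = Set.univ := by
        refine Set.eq_univ_of_forall fun a => ⟨?_, ?_⟩
        · rw [hword a, ← hword a₀]
          exact ha₀.1.1
        · rw [← ha₀.1.2]
          funext k
          unfold edgeTrace
          rw [heval a, heval a₀]
      rw [huniv, measure_univ_eq_top hT hd hreg (O := O) (by rw [hμ]; exact one_ne_zero)] at hfin
      exact lt_irrefl _ hfin
    · refine Filter.Eventually.of_forall fun a => ?_
      rw [hword a]
      exact (hΓ γ γ.2 fun h => hγ (Subtype.ext h)).subset fun x hx => hx.2
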